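/- arXiv:1310.8522 — 9 statements merged into one kernel-verified Lean document; each statement's English description precedes it below -/
import Mathlib

section
/- Let q be a prime power and n, t positive integers. There exists a (t-1)-spread of PG(n-1,q) — that is, a set S of t-dimensional F_q-subspaces of the vector space F_q^n such that any two distinct members of S intersect in the zero subspace and every nonzero vector of F_q^n lies in some member of S — if and only if t divides n. -/
open Module

/-- Subspaces of dimension `t` that partition the nonzero vectors of `V` have sizes that force
`q ^ t - 1` to divide `q ^ dim V - 1`. -/
theorem card_pow_sub_one_dvd_of_spread {F V : Type*} [Field F] [Fintype F] [AddCommGroup V]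
    [Module F V] [FiniteDimensional F V] {t : ℕ} {S : Set (Submodule F V)}
    (hdim : ∀ W ∈ S, finrank F W = t)
    (hdisj : ∀ W ∈ S, ∀ W' ∈ S, W ≠ W' → W ⊓ W' = ⊥)
    (hcover : ∀ v : V, v ≠ 0 → ∃ W ∈ S, v ∈ W) :
    Fintype.card F ^ t - 1 ∣ Fintype.card F ^ finrank F V - 1 := by
  classical
  have : Finite V := Module.finite_of_finite F
  have := Fintype.ofFinite V
  have hfin : S.Finite := Set.toFinite S
  have hunion : (Finset.univ.erase (0 : V)) =
      hfin.toFinset.biUnion fun W => (Finset.univ.filter (· ∈ W)).erase 0 := by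
    ext v
    simp only [Finset.mem_erase, Finset.mem_univ, Finset.mem_biUnion, Finset.mem_filter,
      Set.Finite.mem_toFinset, true_and, and_true]
    exact ⟨fun hv => (hcover v hv).imp fun W hW => ⟨hW.1, hv, hW.2⟩, fun ⟨_, _, hv, _⟩ => hv⟩
  have hcardV : (Finset.univ.erase (0 : V)).card = Fintype.card F ^ finrank F V - 1 := by
    rw [Finset.card_erase_of_mem (Finset.mem_univ _), Finset.card_univ,
      Module.card_eq_pow_finrank (K := F)]
  rw [← hcardV, hunion, Finset.card_biUnion]
  · refine Finset.dvd_sum fun W hW => ?_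
    rw [Finset.card_erase_of_mem (by simp), ← Fintype.card_subtype,
      ← hdim W (hfin.mem_toFinset.mp hW)]
    exact dvd_of_eq (congrArg (· - 1) (Module.card_eq_pow_finrank (K := F) (V := W)).symm)
  · intro W hW W' hW' hne
    refine Finset.disjoint_left.mpr ?_
    intro v hv hv'
    simp only [Finset.mem_erase, Finset.mem_filter, Finset.mem_univ, true_and] at hv hv'
    have hmem : v ∈ W ⊓ W' := ⟨hv.2, hv'.2⟩
    rw [hdisj W (hfin.mem_toFinset.mp hW) W' (hfin.mem_toFinset.mp hW') hne] at hmem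
    exact hv.1 hmem

/-- Divisibility of `q ^ n - 1` by `q ^ t - 1` passes to the exponents. -/
theorem dvd_of_pow_sub_one_dvd_pow_sub_one {q n t : ℕ} (hq : 1 < q)
    (h : q ^ t - 1 ∣ q ^ n - 1) : t ∣ n := by
  have hgcd := Nat.gcd_eq_left h
  rw [Nat.pow_sub_one_gcd_pow_sub_one] at hgcd
  have hpow : q ^ t.gcd n = q ^ t := by
    have h1 := Nat.pow_pos (n := t.gcd n) (zero_lt_one.trans hq)
    have h2 := Nat.pow_pos (n := t) (zero_lt_one.trans hq)
    omega
  exact Nat.gcd_eq_left_iff_dvd.mp (Nat.pow_right_injective hq hpow)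

/-- The `K`-lines of a `K`-vector space, viewed over a subfield `F` and transported along an
`F`-linear equivalence, form a spread of `[K : F]`-dimensional subspaces. -/
theorem exists_spread_of_linearEquiv {F K V U : Type*} [Field F] [Field K] [Algebra F K]
    [AddCommGroup V] [Module F V] [Module K V] [IsScalarTower F K V]
    [AddCommGroup U] [Module F U] (e : V ≃ₗ[F] U) :
    ∃ S : Set (Submodule F U),
      (∀ W ∈ S, finrank F W = finrank F K) ∧
      (∀ W ∈ S, ∀ W' ∈ S, W ≠ W' → W ⊓ W' = ⊥) ∧
      (∀ u : U, u ≠ 0 → ∃ W ∈ S, u ∈ W) := by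
  let line (v : V) : Submodule F U := ((K ∙ v).restrictScalars F).map e.toLinearMap
  refine ⟨line '' {0}ᶜ, ?_, ?_, ?_⟩
  · rintro _ ⟨v, hv, rfl⟩
    rw [LinearEquiv.finrank_map_eq]
    exact ((LinearEquiv.toSpanNonzeroSingleton K V v hv).restrictScalars F).finrank_eq.symm
  · rintro _ ⟨v, -, rfl⟩ _ ⟨w, -, rfl⟩ hne
    rw [Submodule.eq_bot_iff]
    rintro _ ⟨⟨x, hxv, rfl⟩, y, hyw, hyx⟩
    obtain rfl : y = x := e.injective hyx
    by_contra hx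
    have hy : y ≠ 0 := fun h => hx (by simp [h])
    have span_eq {z : V} (hz : y ∈ K ∙ z) : K ∙ y = K ∙ z := by
      obtain ⟨a, rfl⟩ := Submodule.mem_span_singleton.mp hz
      have ha : a ≠ 0 := fun h => hy (by simp [h])
      exact Submodule.span_singleton_smul_eq ha.isUnit z
    have hvw : K ∙ v = K ∙ w := (span_eq hxv).symm.trans (span_eq hyw)
    exact hne (by simp only [line, hvw])
  · intro u hu
    refine ⟨line (e.symm u), ⟨_, by simpa using hu, rfl⟩, e.symm u, ?_, by simp⟩
    exact Submodule.mem_span_singleton_self (R := K) (e.symm u)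

/-- There exists a `(t-1)`-spread of `PG(n-1,q)` — i.e. a set `S` of `t`-dimensional
`F_q`-subspaces of `F_q^n` that pairwise intersect trivially and cover all nonzero
vectors — if and only if `t` divides `n`. -/
theorem spread_exists_iff_dvd (q n t : ℕ) (hn : 0 < n) (ht : 0 < t)
    (F : Type) [Field F] [Fintype F] (hq : Fintype.card F = q) :
    (∃ S : Set (Submodule F (Fin n → F)),
      (∀ W ∈ S, finrank F W = t) ∧
      (∀ W ∈ S, ∀ W' ∈ S, W ≠ W' → W ⊓ W' = ⊥) ∧
      (∀ v : Fin n → F, v ≠ 0 → ∃ W ∈ S, v ∈ W)) ↔ t ∣ n := by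
  constructor
  · rintro ⟨S, hdim, hdisj, hcover⟩
    have h := card_pow_sub_one_dvd_of_spread hdim hdisj hcover
    rw [finrank_fin_fun] at h
    exact dvd_of_pow_sub_one_dvd_pow_sub_one Fintype.one_lt_card h
  · rintro ⟨m, rfl⟩
    obtain ⟨p, _⟩ := CharP.exists F
    have : Fact p.Prime := ⟨CharP.char_is_prime F p⟩
    have : NeZero t := ⟨ht.ne'⟩
    let K := FiniteField.Extension F p t
    have hK : finrank F K = t := FiniteField.finrank_extension F p t
    have e : (Fin m → K) ≃ₗ[F] (Fin (t * m) → F) :=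
      LinearEquiv.ofFinrankEq _ _ (by simp [Module.finrank_pi_fintype, hK, mul_comm])
    simpa only [hK] using exists_spread_of_linearEquiv (K := K) e
end

section
/- Let q be a prime power, r, t positive integers, F = F_q, L = F_{q^t}, V = L^r, and let Tr : L → F denote the field trace. Let σ be a field automorphism of L and let β be a reflexive σ-sesquilinear form on V (i.e., β is additive in both arguments, L-linear in the first argument and σ-semilinear in the second, and β(x,y) = 0 implies β(y,x) = 0). For α ∈ L define the F-bilinear form (L_α β)(x,y) = Tr(α · β(x,y)) on V regarded as an F-vector space. Then L_α β is non-degenerate (i.e., if (L_α β)(x,y) = 0 for all y ∈ V then x = 0) if and only if β is non-degenerate and α ≠ 0. -/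
open Module

/-- (Gill) For a reflexive `σ`-sesquilinear form `β` on `V = F_{q^t}^r` and `α ∈ F_{q^t}`,
the `F_q`-bilinear form `(x,y) ↦ Tr(α · β(x,y))` is non-degenerate if and only if `β` is
non-degenerate and `α ≠ 0`. -/
theorem trace_sesquilinear_nondegenerate_iff (q r t : ℕ) (hr : 0 < r) (ht : 0 < t)
    (F : Type) [Field F] [Fintype F] (hq : Fintype.card F = q)
    (L : Type) [Field L] [Fintype L] [Algebra F L] (hL : Fintype.card L = q ^ t)
    (σ : L ≃+* L)
    (β : (Fin r → L) → (Fin r → L) → L)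
    (hadd₁ : ∀ x x' y, β (x + x') y = β x y + β x' y)
    (hadd₂ : ∀ x y y', β x (y + y') = β x y + β x y')
    (hlin : ∀ (c : L) (x y), β (c • x) y = c * β x y)
    (hsemi : ∀ (c : L) (x y), β x (c • y) = σ c * β x y)
    (hrefl : ∀ x y, β x y = 0 → β y x = 0)
    (α : L) :
    (∀ x, (∀ y, Algebra.trace F L (α * β x y) = 0) → x = 0) ↔
      ((∀ x, (∀ y, β x y = 0) → x = 0) ∧ α ≠ 0) := by
  constructor
  · intro h
    refine ⟨fun x hx => h x fun y => by simp [hx y], ?_⟩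
    rintro rfl
    have h_one : (fun _ : Fin r => (1 : L)) = 0 := h _ fun y => by simp
    exact one_ne_zero (congrFun h_one ⟨0, hr⟩)
  · rintro ⟨hβ, hα⟩ x hx
    refine hβ x fun y => ?_
    have h_zero : α * β x y = 0 := by
      refine (traceForm_nondegenerate F L).1 _ fun c => ?_
      have h_scaled := hx (σ.symm c • y)
      rw [hsemi, RingEquiv.apply_symm_apply] at h_scaled
      rw [Algebra.traceForm_apply, mul_assoc, mul_comm (β x y)]
      exact h_scaled
    exact (mul_eq_zero.mp h_zero).resolve_left hα
end

section
/- Let q be a prime power, t, n positive integers, F = F_q, L = F_{q^t}, V = L^{2n}, Tr : L → F the field trace, and α ∈ L, α ≠ 0. Let Q be a non-degenerate quadratic form on V over L of hyperbolic type, i.e., admitting a totally singular L-subspace of L-dimension n. Then the quadratic form Q'(x) = Tr(α Q(x)) on V regarded as an F-vector space of dimension 2nt admits a totally singular F-subspace of F-dimension nt; that is, if Q' is non-degenerate then Q' is of hyperbolic type. -/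
open Module

/-- Field reduction preserves the hyperbolic type: if `Q` is a non-degenerate quadratic
form on `V = F_{q^t}^{2n}` admitting a totally singular `F_{q^t}`-subspace of dimension
`n` (hyperbolic type), and `α ≠ 0`, then the `F_q`-quadratic form `x ↦ Tr(α Q(x))` on `V`
(an `F_q`-space of dimension `2nt`) admits a totally singular `F_q`-subspace of dimension
`nt`. -/
theorem trace_quadratic_hyperbolic (q t n : ℕ) (ht : 0 < t) (hn : 0 < n)
    (F : Type) [Field F] [Fintype F] (hq : Fintype.card F = q)
    (L : Type) [Field L] [Fintype L] [Algebra F L] (hL : Fintype.card L = q ^ t)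
    (α : L) (hα : α ≠ 0)
    (Q : (Fin (2 * n) → L) → L)
    (hQhom : ∀ (c : L) (x), Q (c • x) = c ^ 2 * Q x)
    (B : (Fin (2 * n) → L) →ₗ[L] (Fin (2 * n) → L) →ₗ[L] L)
    (hB : ∀ x y, B x y = Q (x + y) - Q x - Q y)
    (hnd : ¬ ∃ x, x ≠ 0 ∧ Q x = 0 ∧ ∀ y, B x y = 0)
    (hhyp : ∃ W : Submodule L (Fin (2 * n) → L),
      finrank L W = n ∧ ∀ x ∈ W, Q x = 0) :
    ∃ W' : Submodule F (Fin (2 * n) → L),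
      finrank F W' = n * t ∧ ∀ x ∈ W', Algebra.trace F L (α * Q x) = 0 := by
  obtain ⟨W, hW, hQW⟩ := hhyp
  refine ⟨W.restrictScalars F, ?_, fun x hx => by simp [hQW x hx]⟩
  have hFL : finrank F L = t := by
    have h := Module.card_eq_pow_finrank (K := F) (V := L)
    rw [hL, hq] at h
    exact (Nat.pow_right_injective (hq ▸ Fintype.one_lt_card (α := F)) h).symm
  have h : finrank F L * finrank L W = finrank F W := Module.finrank_mul_finrank F L W
  rw [hFL, hW, mul_comm] at h
  exact h.symm
end

section
/- Let q be a prime power, t, n positive integers, F = F_q, L = F_{q^t}, V = L^{2n}, Tr : L → F the field trace, and α ∈ L, α ≠ 0. Let Q be a non-degenerate quadratic form on V over L of elliptic type, i.e., every totally singular L-subspace of V has L-dimension at most n - 1. Then every F-subspace of V (regarded as an F-vector space of dimension 2nt) on which the quadratic form Q'(x) = Tr(α Q(x)) vanishes identically has F-dimension at most nt - 1; that is, Q' is again of elliptic type. -/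
open Module

section CharacterSums

open scoped Classical

variable {K V : Type*} [Field K] [AddCommGroup V] [Module K V] [Fintype V]

/-- The character sum of a quadratic form only sees the orthogonal complement of a totally
singular subspace. -/
theorem sum_addChar_eq_sum_orthogonal (Q : QuadraticForm K V) {ψ : AddChar K ℂ} (hψ : ψ ≠ 1)
    (W : Submodule K V) (hW : ∀ x ∈ W, Q x = 0) :
    ∑ x, ψ (Q x) = ∑ x : LinearMap.BilinForm.orthogonal Q.polarBilin W, ψ (Q x) := by
  have key (x : V) : ∑ w : W, ψ (Q (x + w)) =
      if x ∈ LinearMap.BilinForm.orthogonal Q.polarBilin W then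
        (Fintype.card W : ℂ) * ψ (Q x) else 0 := by
    let χ : AddChar W ℂ :=
      ψ.compAddMonoidHom ((Q.polarBilin.flip x).comp W.subtype).toAddMonoidHom
    have hχ (w : W) : χ w = ψ (Q.polarBilin w x) := rfl
    have hsum : ∑ w : W, ψ (Q (x + w)) = ψ (Q x) * ∑ w, χ w := by
      rw [Finset.mul_sum]
      refine Finset.sum_congr rfl fun w _ => ?_
      rw [hχ, ← AddChar.map_add_eq_mul, QuadraticMap.map_add Q x w, hW w w.2, add_zero,
        QuadraticMap.polar_comm, QuadraticMap.polarBilin_apply_apply]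
    rw [hsum, AddChar.sum_eq_ite]
    have hiff : χ = 0 ↔ x ∈ LinearMap.BilinForm.orthogonal Q.polarBilin W := by
      rw [LinearMap.BilinForm.mem_orthogonal_iff]
      constructor
      · intro h w hw
        by_contra hne
        apply AddChar.IsPrimitive.of_ne_one hψ hne
        ext c
        have : χ ⟨c • w, W.smul_mem c hw⟩ = 1 := by rw [h]; rfl
        rw [hχ, map_smul, LinearMap.smul_apply, smul_eq_mul, mul_comm] at this
        simpa using this
      · intro h
        ext w
        rw [hχ, h w w.2]
        simp
    by_cases hx : x ∈ LinearMap.BilinForm.orthogonal Q.polarBilin W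
    · rw [if_pos hx, if_pos (hiff.2 hx), mul_comm]
    · rw [if_neg hx, if_neg (mt hiff.1 hx), mul_zero]
  have hcard : (Fintype.card W : ℂ) ≠ 0 := by exact_mod_cast Fintype.card_ne_zero
  apply mul_left_cancel₀ hcard
  calc (Fintype.card W : ℂ) * ∑ x, ψ (Q x)
      = ∑ _w : W, ∑ x, ψ (Q x) := by simp
    _ = ∑ w : W, ∑ x, ψ (Q (x + w)) := by
        refine Finset.sum_congr rfl fun w _ => ?_
        exact (Equiv.sum_comp (Equiv.addRight (w : V)) fun x => ψ (Q x)).symm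
    _ = ∑ x, if x ∈ LinearMap.BilinForm.orthogonal Q.polarBilin W then
          (Fintype.card W : ℂ) * ψ (Q x) else 0 := by
        rw [Finset.sum_comm]
        exact Finset.sum_congr rfl fun x _ => key x
    _ = _ := by
        rw [← Finset.sum_filter, Finset.mul_sum]
        exact Finset.sum_subtype _ (by simp) fun x => (Fintype.card W : ℂ) * ψ (Q x)

/-- The character sum of a nondegenerate form with a totally singular subspace of half the
dimension is positive. -/
theorem sum_addChar_eq_card (Q : QuadraticForm K V)
    (hQ : ∀ r, (∀ y, QuadraticMap.polar Q r y = 0) → r = 0)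
    {ψ : AddChar K ℂ} (hψ : ψ ≠ 1) (W : Submodule K V) (hW : ∀ x ∈ W, Q x = 0)
    (hdim : finrank K V ≤ 2 * finrank K W) :
    ∑ x, ψ (Q x) = Nat.card W := by
  have : FiniteDimensional K V := Module.Finite.of_finite
  have hle : W ≤ LinearMap.BilinForm.orthogonal Q.polarBilin W := fun x hx y hy => by
    simp [QuadraticMap.polar, hW _ hx, hW _ hy, hW _ (W.add_mem hy hx)]
  have hker : Q.polarBilin.ker = ⊥ := by
    rw [LinearMap.ker_eq_bot']
    exact fun r hr => hQ r fun y => LinearMap.congr_fun hr y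
  have h := LinearMap.BilinForm.finrank_add_finrank_orthogonal' (B := Q.polarBilin) W
  rw [hker, inf_bot_eq, finrank_bot, add_zero] at h
  have heq : W = LinearMap.BilinForm.orthogonal Q.polarBilin W :=
    Submodule.eq_of_le_of_finrank_le hle (by omega)
  rw [sum_addChar_eq_sum_orthogonal Q hψ W hW,
    Fintype.sum_congr _ (fun _ => (1 : ℂ)) fun x => by
      rw [hW x (heq.ge x.2), AddChar.map_zero_eq_one]]
  rw [← heq]
  simp

variable [Fintype K]

/-- If all totally singular subspaces have less than half the dimension of the space, the
character sums of the nonzero multiples of the form add up to a negative integer. -/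
theorem sum_sum_mulShift_neg (Q : QuadraticForm K V) {n : ℕ} (hV : finrank K V = 2 * n)
    (hQ : ∀ W : Submodule K V, (∀ x ∈ W, Q x = 0) → finrank K W < n)
    {ψ : AddChar K ℂ} (hψ : ψ ≠ 1) :
    ∃ m : ℕ, 0 < m ∧ ∑ a : Kˣ, ∑ x, ψ.mulShift a (Q x) = -(m : ℂ) := by
  have : FiniteDimensional K V := Module.Finite.of_finite
  obtain ⟨W, hW⟩ := (Set.toFinite {W : Submodule K V | ∀ x ∈ W, Q x = 0}).exists_maximal
    ⟨⊥, by simp⟩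
  have hWs : ∀ x ∈ W, Q x = 0 := hW.prop
  have hle : W ≤ LinearMap.BilinForm.orthogonal Q.polarBilin W := fun x hx y hy => by
    simp [QuadraticMap.polar, hWs _ hx, hWs _ hy, hWs _ (W.add_mem hy hx)]
  have hmem (x : V) (hx : x ∈ LinearMap.BilinForm.orthogonal Q.polarBilin W) : Q x = 0 ↔ x ∈ W := by
    refine ⟨fun h0 => ?_, hWs x⟩
    have hsup : W ⊔ K ∙ x ≤ W := by
      refine hW.le_of_ge (fun z hz => ?_) le_sup_left
      obtain ⟨w, hw, y, hy, rfl⟩ := Submodule.mem_sup.1 hz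
      obtain ⟨c, rfl⟩ := Submodule.mem_span_singleton.1 hy
      have hB : QuadraticMap.polar Q w x = 0 := hx w hw
      rw [QuadraticMap.map_add Q, hWs w hw, QuadraticMap.map_smul, h0,
        QuadraticMap.polar_smul_right, hB]
      simp
    exact hsup (Submodule.mem_sup_right (Submodule.mem_span_singleton_self x))
  set U := LinearMap.BilinForm.orthogonal Q.polarBilin W with hU
  have hunits (c : K) : ∑ a : Kˣ, ψ (a * c) = (if c = 0 then (Fintype.card K : ℂ) else 0) - 1 := by
    have h := AddChar.sum_mulShift c (AddChar.IsPrimitive.of_ne_one hψ)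
    rw [← Fintype.sum_subtype_add_sum_subtype (fun a : K => a ≠ 0)] at h
    rw [← Fintype.sum_equiv unitsEquivNeZero.symm (fun a : {a : K // a ≠ 0} => ψ (a * c))
      (fun a : Kˣ => ψ (a * c)) (fun a => rfl)]
    have : ∑ a : {a : K // ¬ a ≠ 0}, ψ (a * c) = 1 := by
      rw [Fintype.sum_eq_single (⟨0, by simp⟩ : {a : K // ¬ a ≠ 0})]
      · simp
      · rintro ⟨a, ha⟩ h
        exact absurd (Subtype.ext (not_not.1 ha)) h
    rw [this] at h
    push_cast at h
    rw [← h, add_sub_cancel_right]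
  have hsum : ∑ a : Kˣ, ∑ x, ψ.mulShift a (Q x)
      = (Fintype.card K : ℂ) * Fintype.card W - Fintype.card U := by
    have h1 (a : Kˣ) : ∑ x, ψ.mulShift a (Q x) = ∑ x : U, ψ (a * Q x) :=
      sum_addChar_eq_sum_orthogonal Q (AddChar.IsPrimitive.of_ne_one hψ a.ne_zero) W hWs
    rw [Finset.sum_congr rfl fun a _ => h1 a, Finset.sum_comm]
    simp_rw [hunits]
    rw [Finset.sum_sub_distrib, ← Finset.sum_filter]
    have : (Finset.univ.filter fun x : U => Q x = 0).card = Fintype.card W := by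
      rw [← Fintype.card_subtype]
      exact Fintype.card_congr
        { toFun := fun x => ⟨x.1, (hmem _ x.1.2).1 x.2⟩
          invFun := fun w => ⟨⟨w, hle w.2⟩, hWs w w.2⟩
          left_inv := fun x => rfl
          right_inv := fun w => rfl }
    simp [this, mul_comm]
  have hdim := LinearMap.BilinForm.finrank_add_finrank_orthogonal' (B := Q.polarBilin) W
  rw [← hU] at hdim
  have hWn := hQ W hWs
  have hlt : Fintype.card K * Fintype.card W < Fintype.card U := by
    rw [Module.card_eq_pow_finrank (K := K) (V := W), Module.card_eq_pow_finrank (K := K) (V := U),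
      ← pow_succ']
    exact Nat.pow_lt_pow_right Fintype.one_lt_card (by omega)
  refine ⟨Fintype.card U - Fintype.card K * Fintype.card W, by omega, ?_⟩
  rw [hsum, Nat.cast_sub hlt.le]
  push_cast
  ring

/-- In odd characteristic, multiplying by a nonsquare changes the sign of a quadratic
Gauss sum. -/
theorem sum_addChar_nonsquare_mul_sq (hK : ringChar K ≠ 2) {ψ : AddChar K ℂ} (hψ : ψ ≠ 1)
    {c : K} (hc : ¬ IsSquare c) :
    ∑ t, ψ (c * (t * t)) = -∑ t, ψ (t * t) := by
  have hc0 : c ≠ 0 := by rintro rfl; exact hc IsSquare.zero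
  have hsq (f : K → ℂ) : ∑ t, f (t * t) = ∑ s, ((quadraticChar K s : ℂ) + 1) * f s := by
    rw [← Finset.sum_fiberwise (s := Finset.univ) (g := fun t : K => t * t)]
    refine Finset.sum_congr rfl fun s _ => ?_
    have h := quadraticChar_card_sqrts hK s
    rw [Finset.sum_congr rfl (g := fun _ => f s)
      (fun t ht => by rw [(Finset.mem_filter.1 ht).2]), Finset.sum_const, nsmul_eq_mul]
    congr 1
    have h' : ((Finset.univ.filter fun t : K => t * t = s).card : ℤ) = quadraticChar K s + 1 := by
      rw [← h]
      congr 2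
      ext t
      simp [sq]
    exact_mod_cast h'
  have hχ (s : K) : quadraticChar K (c * s) = -quadraticChar K s := by
    rw [map_mul, quadraticChar_neg_one_iff_not_isSquare.2 hc, neg_one_mul]
  have h1 : ∑ s, ((quadraticChar K s : ℂ) + 1) * ψ s
      = ∑ s, (-(quadraticChar K s : ℂ) + 1) * ψ (c * s) := by
    rw [← Equiv.sum_comp (Equiv.mulLeft₀ c hc0)]
    refine Finset.sum_congr rfl fun s _ => ?_
    simp [hχ]
  have h0 : ∑ s, ψ (c * s) = 0 := by
    rw [← AddChar.sum_eq_zero_of_ne_one hψ]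
    exact Equiv.sum_comp (Equiv.mulLeft₀ c hc0) ψ
  rw [hsq fun s => ψ (c * s), hsq ψ, h1, ← add_eq_zero_iff_eq_neg, ← Finset.sum_add_distrib,
    ← mul_zero (2 : ℂ), ← h0, Finset.mul_sum]
  exact Finset.sum_congr rfl fun s _ => by ring

/-- The character sum of a nondegenerate form in even dimension is unchanged by scaling. -/
theorem sum_mulShift_eq (Q : QuadraticForm K V) (hV : Even (finrank K V))
    (hQ : ∀ r, (∀ y, QuadraticMap.polar Q r y = 0) → r = 0)
    {ψ : AddChar K ℂ} (hψ : ψ ≠ 1) {c : K} (hc : c ≠ 0) :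
    ∑ x, ψ.mulShift c (Q x) = ∑ x, ψ (Q x) := by
  by_cases hsq : IsSquare c
  · obtain ⟨d, rfl⟩ := hsq
    have hd : d ≠ 0 := left_ne_zero_of_mul hc
    rw [← Equiv.sum_comp (MulAction.toPerm (Units.mk0 d hd)) fun x => ψ (Q x)]
    refine Finset.sum_congr rfl fun x _ => ?_
    have : MulAction.toPerm (Units.mk0 d hd) x = d • x := rfl
    rw [this, QuadraticMap.map_smul]
    rfl
  have hK : ringChar K ≠ 2 := fun h => hsq (FiniteField.isSquare_of_char_two h c)
  have h2 : (2 : K) ≠ 0 := Ring.two_ne_zero hK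
  have : FiniteDimensional K V := Module.Finite.of_finite
  let : Invertible (2 : K) := invertibleOfNonzero h2
  have hsep : (QuadraticMap.associated (R := K) Q).SeparatingLeft := by
    intro r hr
    refine hQ r fun y => ?_
    rw [← QuadraticMap.polarBilin_apply_apply, ← QuadraticMap.two_nsmul_associated K Q]
    simp only [LinearMap.smul_apply]
    rw [hr y, smul_zero]
  obtain ⟨w, ⟨e⟩⟩ := Q.equivalent_weightedSumSquares_units_of_nondegenerate' hsep
  have hprod (φ : AddChar K ℂ) : ∑ x, φ (Q x) = ∏ i, ∑ t, φ (w i * (t * t)) := by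
    rw [Finset.prod_univ_sum, Fintype.piFinset_univ, ← Equiv.sum_comp e.toLinearEquiv.toEquiv.symm]
    refine Finset.sum_congr rfl fun y _ => ?_
    have : Q (e.toLinearEquiv.toEquiv.symm y) = ∑ i, (w i : K) * (y i * y i) := by
      have h := e.map_app (e.symm y)
      rw [QuadraticMap.weightedSumSquares_apply] at h
      have h' : e (e.symm y) = y := e.toLinearEquiv.apply_symm_apply y
      rw [h'] at h
      exact h.symm
    rw [this]
    exact map_sum φ.toAddMonoidHom _ _
  have hneg (i : Fin (finrank K V)) :
      ∑ t, ψ.mulShift c (w i * (t * t)) = -∑ t, ψ (w i * (t * t)) := by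
    refine Eq.trans ?_ (sum_addChar_nonsquare_mul_sq hK
      (AddChar.IsPrimitive.of_ne_one hψ (w i).ne_zero) hsq)
    refine Finset.sum_congr rfl fun t _ => ?_
    simp only [AddChar.mulShift_apply]
    congr 1
    ring
  rw [hprod, hprod, Finset.prod_congr rfl fun i _ => hneg i, Finset.prod_neg]
  simp [hV.neg_one_pow]

/-- A quadratic form with nonvanishing character sums and no singular radical vector has
nondegenerate polar form. -/
theorem eq_zero_of_polar_eq_zero (Q : QuadraticForm K V)
    (hQ : ∀ r, Q r = 0 → (∀ y, QuadraticMap.polar Q r y = 0) → r = 0)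
    {ψ : AddChar K ℂ} (hψ : ψ ≠ 1) (hsum : ∑ a : Kˣ, ∑ x, ψ.mulShift a (Q x) ≠ 0)
    (r : V) (hr : ∀ y, QuadraticMap.polar Q r y = 0) : r = 0 := by
  refine hQ r ?_ hr
  by_contra hne
  have hK : ringChar K = 2 := by
    by_contra hK
    have h := hr r
    rw [QuadraticMap.polar_self, nsmul_eq_mul, Nat.cast_ofNat] at h
    exact (mul_ne_zero (Ring.two_ne_zero hK) hne) h
  refine hsum (Finset.sum_eq_zero fun a _ => ?_)
  obtain ⟨b, hb⟩ := AddChar.ne_one_iff.1 (AddChar.IsPrimitive.of_ne_one hψ a.ne_zero)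
  obtain ⟨d, hd⟩ := FiniteField.isSquare_of_char_two hK (b / Q r)
  refine eq_zero_of_mul_eq_self_left hb ?_
  rw [Finset.mul_sum,
    ← Equiv.sum_comp (Equiv.addRight (d • r)) fun x => ψ.mulShift a (Q x)]
  refine Finset.sum_congr rfl fun x _ => ?_
  rw [← AddChar.map_add_eq_mul, Equiv.coe_addRight, QuadraticMap.map_add Q, QuadraticMap.map_smul,
    QuadraticMap.polar_smul_right, QuadraticMap.polar_comm, hr, ← hd, smul_zero, add_zero,
    smul_eq_mul, div_mul_cancel₀ _ hne, add_comm]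

end CharacterSums

/-- Field reduction preserves the elliptic type: if `Q` is a non-degenerate quadratic
form on `V = F_{q^t}^{2n}` all of whose totally singular `F_{q^t}`-subspaces have
dimension at most `n - 1` (elliptic type), and `α ≠ 0`, then every `F_q`-subspace of `V`
(an `F_q`-space of dimension `2nt`) on which `x ↦ Tr(α Q(x))` vanishes identically has
`F_q`-dimension at most `nt - 1`. -/
theorem trace_quadratic_elliptic (q t n : ℕ) (ht : 0 < t) (hn : 0 < n)
    (F : Type) [Field F] [Fintype F] (hq : Fintype.card F = q)
    (L : Type) [Field L] [Fintype L] [Algebra F L] (hL : Fintype.card L = q ^ t)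
    (α : L) (hα : α ≠ 0)
    (Q : (Fin (2 * n) → L) → L)
    (hQhom : ∀ (c : L) (x), Q (c • x) = c ^ 2 * Q x)
    (B : (Fin (2 * n) → L) →ₗ[L] (Fin (2 * n) → L) →ₗ[L] L)
    (hB : ∀ x y, B x y = Q (x + y) - Q x - Q y)
    (hnd : ¬ ∃ x, x ≠ 0 ∧ Q x = 0 ∧ ∀ y, B x y = 0)
    (hell : ∀ W : Submodule L (Fin (2 * n) → L),
      (∀ x ∈ W, Q x = 0) → finrank L W ≤ n - 1) :
    ∀ W' : Submodule F (Fin (2 * n) → L),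
      (∀ x ∈ W', Algebra.trace F L (α * Q x) = 0) → finrank F W' ≤ n * t - 1 := by
  classical
  intro W' hW'
  by_contra! hlt
  have : FiniteDimensional F L := Module.Finite.of_finite
  have hFL : finrank F L = t := by
    have h := Module.card_eq_pow_finrank (K := F) (V := L)
    rw [hL, ← hq] at h
    exact (Nat.pow_right_injective Fintype.one_lt_card h).symm
  let Q₀ : QuadraticForm L (Fin (2 * n) → L) :=
    { toFun := Q
      toFun_smul := fun a x => by rw [hQhom, sq, smul_eq_mul]
      exists_companion' := ⟨B, fun x y => by rw [hB]; ring⟩ }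
  have hpolar (x y) : QuadraticMap.polar Q₀ x y = B x y := (hB x y).symm
  let Q₁ : QuadraticForm F (Fin (2 * n) → L) :=
    (Algebra.trace F L ∘ₗ LinearMap.mulLeft F α).compQuadraticMap' Q₀
  have hQ₁ (x) : Q₁ x = Algebra.trace F L (α * Q₀ x) := rfl
  let ψ := AddChar.FiniteField.primitiveChar_to_Complex F
  have hψ : ψ ≠ 1 := by
    simpa using AddChar.FiniteField.primitiveChar_to_Complex_isPrimitive F one_ne_zero
  let φ : AddChar L ℂ := ψ.compAddMonoidHom (Algebra.trace F L).toAddMonoidHom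
  have hφ : φ ≠ 1 := by
    obtain ⟨b, hb⟩ := AddChar.ne_one_iff.1 hψ
    obtain ⟨a, rfl⟩ := Algebra.trace_surjective F L b
    exact AddChar.ne_one_iff.2 ⟨a, hb⟩
  obtain ⟨m, hm, hsum⟩ := sum_sum_mulShift_neg Q₀ (n := n) (by simp)
    (fun W hW => by have := hell W hW; omega) hφ
  have hnd₀ : ∀ r, (∀ y, QuadraticMap.polar Q₀ r y = 0) → r = 0 := by
    refine eq_zero_of_polar_eq_zero Q₀ (fun r h0 hr => ?_) hφ ?_
    · by_contra hne
      exact hnd ⟨r, hne, h0, fun y => by rw [← hpolar, hr]⟩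
    · rw [hsum, neg_ne_zero]
      exact_mod_cast hm.ne'
  have hnd₁ : ∀ r, (∀ y, QuadraticMap.polar Q₁ r y = 0) → r = 0 := by
    refine fun r hr => hnd₀ r fun y => ?_
    by_contra hne
    obtain ⟨a, ha⟩ := Algebra.trace_surjective F L 1
    have h := hr ((a / (α * QuadraticMap.polar Q₀ r y)) • y)
    have h' : QuadraticMap.polar Q₁ r ((a / (α * QuadraticMap.polar Q₀ r y)) • y) =
        Algebra.trace F L (α * QuadraticMap.polar Q₀ r
          ((a / (α * QuadraticMap.polar Q₀ r y)) • y)) := by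
      simp only [QuadraticMap.polar, hQ₁, mul_sub, map_sub]
    rw [h', QuadraticMap.polar_smul_right, smul_eq_mul, mul_left_comm,
      div_mul_cancel₀ _ (mul_ne_zero hα hne), ha] at h
    exact one_ne_zero h
  have hdim : finrank F (Fin (2 * n) → L) = 2 * (n * t) := by
    rw [Module.finrank_pi_fintype]
    simp [hFL, mul_assoc]
  have hcard := sum_addChar_eq_card Q₁ hnd₁ hψ W' hW' (by omega)
  have heven : Even (finrank L (Fin (2 * n) → L)) := by simp
  have hα' : ∑ x, φ (Q₀ x) = Nat.card W' := by
    rw [← sum_mulShift_eq Q₀ heven hnd₀ hφ hα, ← hcard]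
    rfl
  rw [Finset.sum_congr rfl fun a _ => (sum_mulShift_eq Q₀ heven hnd₀ hφ a.ne_zero).trans hα',
    Finset.sum_const, nsmul_eq_mul, eq_neg_iff_add_eq_zero] at hsum
  norm_cast at hsum
  omega
end

section
/- Let q be an odd prime power, let F = F_q and L = F_{q^2}, let Tr : L → F be the field trace, and let β ∈ L, β ≠ 0. Then there exists u ∈ L, u ≠ 0, with Tr(β u²) = 0 if and only if either (q ≡ 1 mod 4 and β is a non-square in L) or (q ≡ 3 mod 4 and β is a square in L). -/
open Module

/-- The trace of the quadratic extension of a finite field with `q` elements is `x + x ^ q`. -/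
lemma algebraMap_trace_eq_add_pow_card {F L : Type*} [Field F] [Fintype F] [Field L] [Fintype L]
    [Algebra F L] (hL : Fintype.card L = Fintype.card F ^ 2) (x : L) :
    algebraMap F L (Algebra.trace F L x) = x + x ^ Fintype.card F := by
  have hrank : finrank F L = 2 := by
    rw [Module.card_eq_pow_finrank (K := F)] at hL
    exact Nat.pow_right_injective Fintype.one_lt_card hL
  rw [FiniteField.algebraMap_trace_eq_sum_pow, hrank]
  simp [Finset.sum_range_succ]

/-- A nonzero trace-zero element of the quadratic extension of a finite field with `q` elements,
`q` odd, is a square if and only if `q ≡ 3 mod 4`. -/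
lemma isSquare_iff_of_trace_eq_zero {F L : Type*} [Field F] [Fintype F] [Field L] [Fintype L]
    [Algebra F L] (hodd : Odd (Fintype.card F)) (hL : Fintype.card L = Fintype.card F ^ 2)
    (hchar : ringChar L ≠ 2) {x : L} (hx : x ≠ 0) (htr : Algebra.trace F L x = 0) :
    IsSquare x ↔ Fintype.card F % 4 = 3 := by
  have hadd := algebraMap_trace_eq_add_pow_card hL x
  rw [htr, map_zero] at hadd
  rw [FiniteField.isSquare_iff hchar hx, hL]
  obtain ⟨k, hk⟩ := hodd
  rw [hk] at hadd ⊢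
  have hpow : x ^ (2 * k) = -1 := by
    apply mul_left_cancel₀ hx
    linear_combination -hadd
  have hexp : (2 * k + 1) ^ 2 / 2 = 2 * k * (k + 1) := by
    rw [show (2 * k + 1) ^ 2 = 2 * (2 * k * (k + 1)) + 1 by ring]
    omega
  rw [hexp, pow_mul, hpow]
  have hne : (-1 : L) ≠ 1 := Ring.neg_one_ne_one_of_char_ne_two hchar
  rw [neg_one_pow_eq_one_iff_even hne]
  constructor
  · rintro ⟨m, hm⟩
    omega
  · intro h
    exact ⟨(k + 1) / 2, by omega⟩

/-- If two nonzero elements of a finite field are both squares or both non-squares, their quotient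
is a square. -/
lemma isSquare_div_of_isSquare_iff {L : Type*} [Field L] [Fintype L] (hchar : ringChar L ≠ 2)
    {x y : L} (hx : x ≠ 0) (hy : y ≠ 0) (h : IsSquare x ↔ IsSquare y) : IsSquare (x / y) := by
  rw [FiniteField.isSquare_iff hchar (div_ne_zero hx hy), div_pow]
  rw [FiniteField.isSquare_iff hchar hx, FiniteField.isSquare_iff hchar hy] at h
  rcases FiniteField.pow_dichotomy hchar hx with h1 | h1 <;>
    rcases FiniteField.pow_dichotomy hchar hy with h2 | h2 <;> simp_all

/-- For `q` odd, `L = F_{q^2}` and `β ∈ L*`: there exists `u ∈ L*` with `Tr(β u²) = 0`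
if and only if (`q ≡ 1 mod 4` and `β` is a non-square in `L`) or (`q ≡ 3 mod 4` and `β`
is a square in `L`). -/
theorem trace_beta_usq_eq_zero_iff (q : ℕ)
    (F : Type) [Field F] [Fintype F] (hq : Fintype.card F = q) (hodd : Odd q)
    (L : Type) [Field L] [Fintype L] [Algebra F L] (hL : Fintype.card L = q ^ 2)
    (β : L) (hβ : β ≠ 0) :
    (∃ u : L, u ≠ 0 ∧ Algebra.trace F L (β * u ^ 2) = 0) ↔
      ((q % 4 = 1 ∧ ¬ ∃ γ : L, γ ^ 2 = β) ∨ (q % 4 = 3 ∧ ∃ γ : L, γ ^ 2 = β)) := by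
  subst hq
  have hchar : ringChar L ≠ 2 := fun h => by
    have heven := FiniteField.even_card_of_char_two h
    rw [hL, ← Nat.even_iff] at heven
    exact Nat.not_even_iff_odd.mpr hodd.pow heven
  have hsquare : (∃ γ : L, γ ^ 2 = β) ↔ IsSquare β := by
    simp only [isSquare_iff_exists_sq, eq_comm]
  have hmod : Fintype.card F % 4 = 1 ↔ ¬ Fintype.card F % 4 = 3 := by
    have := Nat.odd_iff.mp hodd
    omega
  have hgoal : (∃ u : L, u ≠ 0 ∧ Algebra.trace F L (β * u ^ 2) = 0) ↔
      (IsSquare β ↔ Fintype.card F % 4 = 3) := by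
    constructor
    · rintro ⟨u, hu, htr⟩
      have hu2 : u ^ 2 ≠ 0 := pow_ne_zero 2 hu
      rw [← isSquare_iff_of_trace_eq_zero hodd hL hchar (mul_ne_zero hβ hu2) htr]
      refine ⟨fun h => h.mul (IsSquare.sq u), fun h => ?_⟩
      simpa [hu2] using h.div (IsSquare.sq u)
    · intro h
      have hlt : Fintype.card F < Fintype.card L := by
        rw [hL]
        exact lt_self_pow₀ Fintype.one_lt_card one_lt_two
      obtain ⟨a, b, hab, htr⟩ := Fintype.exists_ne_map_eq_of_card_lt (Algebra.trace F L) hlt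
      have hne : a - b ≠ 0 := sub_ne_zero.mpr hab
      have hzero : Algebra.trace F L (a - b) = 0 := by rw [map_sub, htr, sub_self]
      obtain ⟨u, hu⟩ := (isSquare_iff_exists_sq _).mp <| isSquare_div_of_isSquare_iff hchar hne hβ
        ((isSquare_iff_of_trace_eq_zero hodd hL hchar hne hzero).trans h.symm)
      refine ⟨u, ?_, ?_⟩
      · rintro rfl
        exact div_ne_zero hne hβ (by simpa using hu)
      · rwa [← hu, mul_div_cancel₀ _ hβ]
  rw [hgoal, hsquare, hmod]
  tauto
end

section
/- Let q be a prime power, s and t positive integers with s dividing t, F = F_q, L = F_{q^t}, and let K = F_{q^s} be the subfield of L with q^s elements. Let V = L² and let M = { L·(g w) : w ∈ K², w ≠ 0 } for some g ∈ GL(2, L) (an F_{q^s}-subline PG(1,q^s) of PG(1,q^t)). Then for every F-subspace U of V with associated linear set B(U) = { L·u : u ∈ U, u ≠ 0 }, either M ⊆ B(U) or |M ∩ B(U)| ≤ (t/s)·(q^{s-1} + q^{s-2} + ... + q + 1). -/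
open Module Polynomial

/-- A determinant whose diagonal is perturbed by positive powers of `X` does not vanish. -/
theorem det_diagonal_X_pow_sub_C_ne_zero {L ι : Type*} [Field L] [Fintype ι] [DecidableEq ι]
    (k : ι → ℕ) (hk : ∀ i, 0 < k i) (C : Matrix ι ι L) :
    (Matrix.diagonal (fun i => (X : L[X]) ^ k i) - C.map Polynomial.C).det ≠ 0 := by
  intro h
  obtain ⟨v, hv, hv0⟩ := Matrix.exists_mulVec_eq_zero_iff.mpr h
  obtain ⟨j, hj⟩ := Function.ne_iff.mp hv
  obtain ⟨i, -, hi⟩ := Finset.exists_max_image Finset.univ (fun i => (v i).degree)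
    ⟨j, Finset.mem_univ j⟩
  have hvi : v i ≠ 0 := by
    intro h0
    have := hi j (Finset.mem_univ j)
    rw [h0, degree_zero, le_bot_iff, degree_eq_bot] at this
    exact hj this
  have hrow : X ^ k i * v i = ∑ m, Polynomial.C (C i m) * v m := by
    have := congrFun hv0 i
    rw [Matrix.sub_mulVec, Pi.sub_apply, Matrix.mulVec_diagonal, Pi.zero_apply, sub_eq_zero] at this
    simpa [Matrix.mulVec, dotProduct] using this
  have hle : (X ^ k i * v i).natDegree ≤ (v i).natDegree := by
    rw [hrow]
    refine natDegree_sum_le_of_forall_le _ _ fun m _ => (natDegree_C_mul_le _ _).trans ?_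
    exact natDegree_le_natDegree (hi m (Finset.mem_univ m))
  rw [natDegree_X_pow_mul _ hvi] at hle
  have := hk i
  omega

theorem natDegree_det_diagonal_X_pow_sub_C_le {L ι : Type*} [Field L] [Fintype ι] [DecidableEq ι]
    (k : ι → ℕ) (C : Matrix ι ι L) :
    (Matrix.diagonal (fun i => (X : L[X]) ^ k i) - C.map Polynomial.C).det.natDegree
      ≤ ∑ i, k i := by
  rw [← Matrix.det_transpose, Matrix.det_apply]
  refine natDegree_sum_le_of_forall_le _ _ fun σ _ => (natDegree_smul_le _ _).trans ?_
  refine (natDegree_prod_le _ _).trans (Finset.sum_le_sum fun i _ => ?_)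
  rw [Matrix.transpose_apply, Matrix.sub_apply, Matrix.map_apply, Matrix.diagonal_apply]
  refine (natDegree_sub_le _ _).trans ?_
  split_ifs <;> simp

theorem sum_range_mul_pow_mod (q s n : ℕ) :
    ∑ i ∈ Finset.range (s * n), q ^ (i % s) = n * ∑ i ∈ Finset.range s, q ^ i := by
  induction n with
  | zero => simp
  | succ n ih =>
    rw [Nat.mul_succ, Finset.sum_range_add, ih, Nat.succ_mul]
    congr 1
    refine Finset.sum_congr rfl fun i hi => ?_
    rw [Nat.mul_add_mod, Nat.mod_eq_of_lt (Finset.mem_range.mp hi)]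

/-- The powers of Frobenius span the `F`-linear endomorphisms of `L` over `L`. -/
theorem exists_eq_sum_mul_pow_card_pow (F L : Type*) [Field F] [Fintype F] [Field L] [Fintype L]
    [Algebra F L] (ψ : L →ₗ[F] L) :
    ∃ c : Fin (finrank F L) → L,
      ∀ y, ψ y = ∑ i, c i * y ^ Fintype.card F ^ (i : ℕ) := by
  let φ : Fin (finrank F L) → L →ₗ[F] L := fun i =>
    ((FiniteField.frobeniusAlgEquivOfAlgebraic F L ^ (i : ℕ) : L ≃ₐ[F] L) : L →ₐ[F] L).toLinearMap
  have hφ : ∀ i y, φ i y = y ^ Fintype.card F ^ (i : ℕ) := by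
    intro i y
    simp [φ, FiniteField.coe_frobeniusAlgEquivOfAlgebraic_iterate, AlgEquiv.coe_pow]
  have hli : LinearIndependent L φ := by
    have h := (linearIndependent_toLinearMap F L L).comp
      (fun i : Fin (finrank F L) =>
        ((FiniteField.frobeniusAlgEquivOfAlgebraic F L ^ (i : ℕ) : L ≃ₐ[F] L) : L →ₐ[F] L)) ?_
    · exact h
    · intro i j hij
      apply (FiniteField.bijective_frobeniusAlgEquivOfAlgebraic_pow F L).1
      ext y
      exact DFunLike.congr_fun hij y
  have hspan := hli.span_eq_top_of_card_eq_finrank' (by simp [finrank_linearMap_self])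
  have hmem : ψ ∈ Submodule.span L (Set.range φ) := hspan ▸ Submodule.mem_top
  obtain ⟨c, hc⟩ := (Submodule.mem_span_range_iff_exists_fun L).mp hmem
  refine ⟨c, fun y => ?_⟩
  rw [← hc]
  simp [LinearMap.sum_apply, hφ]

/-- An `F`-linear endomorphism of `L` has few eigenvalues (over `L`) in the subfield `K`. -/
theorem ncard_eigenvalues_le (s n : ℕ) (F K L : Type*)
    [Field F] [Fintype F] [Field K] [Fintype K] [Field L] [Fintype L] [Algebra F L] [Algebra K L]
    (hK : Fintype.card K = Fintype.card F ^ s) (hn : finrank F L = s * n) (ψ : L →ₗ[F] L) :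
    {x : K | ∃ y : L, y ≠ 0 ∧ ψ y = algebraMap K L x * y}.ncard
      ≤ n * ∑ i ∈ Finset.range s, Fintype.card F ^ i := by
  classical
  set q := Fintype.card F with hq
  have hq0 : 0 < q := Fintype.card_pos
  have hpow : ∀ i : Fin (finrank F L), ∃ c : Fin (finrank F L) → L,
      ∀ y, ψ y ^ q ^ (i : ℕ) = ∑ m, c m * y ^ q ^ (m : ℕ) := by
    intro i
    obtain ⟨c, hc⟩ := exists_eq_sum_mul_pow_card_pow F L
      (((FiniteField.frobeniusAlgEquivOfAlgebraic F L ^ (i : ℕ) : L ≃ₐ[F] L) :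
        L →ₐ[F] L).toLinearMap ∘ₗ ψ)
    refine ⟨c, fun y => ?_⟩
    rw [← hc]
    simp [FiniteField.coe_frobeniusAlgEquivOfAlgebraic_iterate, AlgEquiv.coe_pow, hq]
  choose C hC using hpow
  let k : Fin (finrank F L) → ℕ := fun i => q ^ ((i : ℕ) % s)
  let f := (Matrix.diagonal (fun i => (X : L[X]) ^ k i) - (Matrix.of C).map Polynomial.C).det
  have hf : f ≠ 0 := det_diagonal_X_pow_sub_C_ne_zero k (fun i => pow_pos hq0 _) _
  have hdeg : f.natDegree ≤ n * ∑ i ∈ Finset.range s, q ^ i := by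
    refine (natDegree_det_diagonal_X_pow_sub_C_le k _).trans_eq ?_
    rw [← sum_range_mul_pow_mod, ← hn, ← Fin.sum_univ_eq_sum_range (fun i => q ^ (i % s))]
  have hmod : ∀ (x : K) (i : ℕ), x ^ q ^ i = x ^ q ^ (i % s) := by
    intro x i
    conv_lhs => rw [← Nat.mod_add_div i s, pow_add, pow_mul q, ← hK, pow_mul]
    exact FiniteField.pow_card_pow _ _
  have hroot : ∀ x : K, (∃ y : L, y ≠ 0 ∧ ψ y = algebraMap K L x * y) →
      algebraMap K L x ∈ f.roots.toFinset := by
    rintro x ⟨y, hy, hxy⟩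
    rw [Multiset.mem_toFinset, mem_roots hf, IsRoot, ← coe_evalRingHom, RingHom.map_det,
      ← Matrix.exists_mulVec_eq_zero_iff]
    refine ⟨fun i => y ^ q ^ (i : ℕ), fun h => ?_, ?_⟩
    · have hpos : 0 < finrank F L := finrank_pos
      exact pow_ne_zero _ hy (congrFun h ⟨0, hpos⟩)
    · ext i
      have hdiag : (evalRingHom (algebraMap K L x)).mapMatrix
          (Matrix.diagonal (fun i => (X : L[X]) ^ k i) - (Matrix.of C).map Polynomial.C)
          = Matrix.diagonal (fun i => algebraMap K L x ^ k i) - Matrix.of C := by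
        ext a b
        by_cases hab : a = b
        · subst hab
          simp
        · simp [hab]
      rw [hdiag, Matrix.sub_mulVec, Pi.sub_apply, Matrix.mulVec_diagonal, Pi.zero_apply,
        sub_eq_zero]
      have h := hC i y
      rw [hxy, mul_pow, ← map_pow, hmod, map_pow] at h
      simpa [Matrix.mulVec, dotProduct, k] using h
  calc _ ≤ (f.roots.toFinset : Set L).ncard :=
        Set.ncard_le_ncard_of_injOn (algebraMap K L) (fun x hx => hroot x hx)
          ((algebraMap K L).injective.injOn) (Finset.finite_toSet _)
    _ ≤ f.natDegree := by
        rw [Set.ncard_coe_finset]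
        exact (Multiset.toFinset_card_le _).trans (card_roots' f)
    _ ≤ _ := hdeg

/-- Any nonzero vector of `K²` is the second column of a matrix of determinant one. -/
theorem exists_det_eq_one {K : Type*} [Field K] (w : Fin 2 → K) (hw : w ≠ 0) :
    ∃ v : Fin 2 → K, v 0 * w 1 - v 1 * w 0 = 1 := by
  by_cases h0 : w 0 = 0
  · have h1 : w 1 ≠ 0 := fun h1 => hw (by ext i; fin_cases i <;> simpa)
    exact ⟨![(w 1)⁻¹, 0], by simp [h1]⟩
  · exact ⟨![0, -(w 0)⁻¹], by simp [h0]⟩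



/-- (Pepe) An `F_q`-linear set `B(U)` of `PG(1,q^t)` either contains a fixed
`F_{q^s}`-subline `PG(1,q^s)` (for `s ∣ t`), or it intersects it in at most
`(t/s)(q^{s-1} + q^{s-2} + ⋯ + 1)` points. -/
theorem linear_set_meets_subline (q s t : ℕ) (hs : 0 < s) (hst : s ∣ t)
    (F : Type) [Field F] [Fintype F] (hq : Fintype.card F = q)
    (K : Type) [Field K] [Fintype K] [Algebra F K] (hK : Fintype.card K = q ^ s)
    (L : Type) [Field L] [Fintype L] [Algebra F L] [Algebra K L]
    [IsScalarTower F K L] (hL : Fintype.card L = q ^ t)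
    (g : (Fin 2 → L) ≃ₗ[L] (Fin 2 → L)) :
    let M : Set (Submodule L (Fin 2 → L)) :=
      {P | ∃ w : Fin 2 → K, w ≠ 0 ∧
        P = Submodule.span L {g (fun i => algebraMap K L (w i))}}
    ∀ U : Submodule F (Fin 2 → L),
      let B : Set (Submodule L (Fin 2 → L)) :=
        {P | ∃ x ∈ U, x ≠ 0 ∧ P = Submodule.span L {x}}
      M ⊆ B ∨ (M ∩ B).ncard ≤ (t / s) * ∑ i ∈ Finset.range s, q ^ i := by
  intro M U B
  obtain ⟨n, rfl⟩ := hst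
  rw [Nat.mul_div_cancel_left _ hs]
  subst hq
  rw [or_iff_not_imp_left, Set.not_subset]
  rintro ⟨_, ⟨w, hw, rfl⟩, hwB⟩
  have hn : finrank F L = s * n :=
    Nat.pow_right_injective Fintype.one_lt_card ((card_eq_pow_finrank (K := F)).symm.trans hL)
  obtain ⟨v, hv⟩ := exists_det_eq_one w hw
  have hvL : algebraMap K L (v 0) * algebraMap K L (w 1)
      - algebraMap K L (v 1) * algebraMap K L (w 0) = 1 := by
    rw [← map_mul, ← map_mul, ← map_sub, hv, map_one]
  have hdecomp : ∀ z : Fin 2 → K,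
      z = (z 0 * w 1 - z 1 * w 0) • v + (v 0 * z 1 - v 1 * z 0) • w := by
    intro z
    ext i
    fin_cases i
    · simp only [Fin.zero_eta, Pi.add_apply, Pi.smul_apply, smul_eq_mul]
      linear_combination (-z 0) * hv
    · simp only [Fin.mk_one, Pi.add_apply, Pi.smul_apply, smul_eq_mul]
      linear_combination (-z 1) * hv
  let ι : (Fin 2 → K) → Fin 2 → L := fun z i => algebraMap K L (z i)
  have hι : ∀ (a : K) (z : Fin 2 → K), ι (a • z) = algebraMap K L a • ι z := by
    intro a z
    ext i
    simp [ι]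
  have hspan : ∀ (a : K) (z : Fin 2 → K), a ≠ 0 →
      Submodule.span L {g (ι (a • z))} = Submodule.span L {g (ι z)} := by
    intro a z ha
    rw [hι, map_smul]
    exact Submodule.span_singleton_smul_eq (IsUnit.mk0 _ (by simpa using ha)) _
  let π₁ : (Fin 2 → L) →ₗ[L] L :=
    (algebraMap K L (w 1) • LinearMap.proj 0 - algebraMap K L (w 0) • LinearMap.proj 1) ∘ₗ
      g.symm.toLinearMap
  let π₂ : (Fin 2 → L) →ₗ[L] L :=
    (algebraMap K L (v 0) • LinearMap.proj 1 - algebraMap K L (v 1) • LinearMap.proj 0) ∘ₗ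
      g.symm.toLinearMap
  have hπ₁ : ∀ z, π₁ (g (ι z)) = algebraMap K L (z 0 * w 1 - z 1 * w 0) := by
    intro z
    simp [π₁, ι, Algebra.smul_def, mul_comm]
  have hπ₂ : ∀ z, π₂ (g (ι z)) = algebraMap K L (v 0 * z 1 - v 1 * z 0) := by
    intro z
    simp [π₂, ι, Algebra.smul_def]
  have hker : ∀ z, π₁ z = 0 → z = π₂ z • g (ι w) := by
    intro z hz
    apply g.symm.injective
    rw [map_smul, g.symm_apply_apply]
    simp only [π₁, π₂, LinearMap.comp_apply, LinearMap.sub_apply, LinearMap.smul_apply,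
      LinearMap.proj_apply, smul_eq_mul, LinearEquiv.coe_coe] at hz ⊢
    ext i
    fin_cases i
    · simp only [Fin.zero_eta, Pi.smul_apply, smul_eq_mul, ι]
      linear_combination (-g.symm z 0) * hvL + algebraMap K L (v 0) * hz
    · simp only [Fin.mk_one, Pi.smul_apply, smul_eq_mul, ι]
      linear_combination (-g.symm z 1) * hvL + algebraMap K L (v 1) * hz
  let p : U →ₗ[F] L := (π₁.restrictScalars F) ∘ₗ U.subtype
  have hp : LinearMap.ker p = ⊥ := by
    rw [LinearMap.ker_eq_bot']
    rintro ⟨z, hzU⟩ hz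
    by_contra hz0
    have hz0' : z ≠ 0 := fun h => hz0 (Subtype.ext h)
    have hzw := hker z hz
    have hne : π₂ z ≠ 0 := fun h => hz0' (by rw [hzw, h, zero_smul])
    refine hwB ⟨z, hzU, hz0', ?_⟩
    rw [hzw]
    exact (Submodule.span_singleton_smul_eq (IsUnit.mk0 _ hne) _).symm
  obtain ⟨r, hr⟩ := p.exists_leftInverse_of_injective hp
  let ψ : L →ₗ[F] L := (π₂.restrictScalars F) ∘ₗ U.subtype ∘ₗ r
  have hψ : ∀ z ∈ U, ψ (π₁ z) = π₂ z := by
    intro z hz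
    have h : r (π₁ z) = ⟨z, hz⟩ := LinearMap.congr_fun hr ⟨z, hz⟩
    simp [ψ, h]
  have hsub : M ∩ B ⊆ (fun x : K => Submodule.span L {g (ι (v + x • w))}) ''
      {x : K | ∃ y : L, y ≠ 0 ∧ ψ y = algebraMap K L x * y} := by
    rintro P ⟨⟨z, hz, rfl⟩, ⟨u, huU, hu, hPu⟩⟩
    change Submodule.span L {g (ι z)} = _ at hPu
    change Submodule.span L {g (ι z)} ∈ _
    obtain ⟨c, rfl⟩ : ∃ c : L, c • g (ι z) = u := by
      rw [← Submodule.mem_span_singleton, hPu]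
      exact Submodule.mem_span_singleton_self u
    have hc : c ≠ 0 := fun h => hu (by rw [h, zero_smul])
    have hdz := hdecomp z
    have hψz := hψ _ huU
    rw [map_smul π₁, map_smul π₂, hπ₁, hπ₂, smul_eq_mul, smul_eq_mul] at hψz
    generalize z 0 * w 1 - z 1 * w 0 = α at hdz hψz
    generalize v 0 * z 1 - v 1 * z 0 = β at hdz hψz
    have hα : α ≠ 0 := by
      rintro rfl
      rw [zero_smul, zero_add] at hdz
      have hβ : β ≠ 0 := by
        rintro rfl
        exact hz (by rw [hdz, zero_smul])
      refine hwB ⟨_, huU, hu, ?_⟩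
      rw [← hPu, hdz, hspan β w hβ]
    have hαL : algebraMap K L α ≠ 0 := by simpa using hα
    refine ⟨β / α, ⟨c * algebraMap K L α, mul_ne_zero hc hαL, ?_⟩, ?_⟩
    · rw [hψz, map_div₀]
      field_simp
    · change Submodule.span L {g (ι (v + (β / α) • w))} = _
      rw [← hspan α _ hα, smul_add, smul_smul, mul_div_cancel₀ _ hα, ← hdz]
  calc (M ∩ B).ncard ≤ _ := Set.ncard_le_ncard hsub (Set.toFinite _)
    _ ≤ _ := Set.ncard_image_le (Set.toFinite _)
    _ ≤ _ := ncard_eigenvalues_le s n F K L hK hn ψ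
end

section
/- Let q > 3 be a prime power, h ≥ 1, F = F_q, L = F_{q^h}, V = L². Let U₁ and U₂ be F-subspaces of V of F-dimension 3, with associated linear sets B(U_i) = { L·u : u ∈ U_i, u ≠ 0 }. Then |B(U₁) ∩ B(U₂)| ≤ 2q + 2 if q is odd, and |B(U₁) ∩ B(U₂)| ≤ 2q + 3 if q is even, provided B(U₁) ≠ B(U₂). -/
open Module

/-- The determinant of the `3 × 3` matrix with rows `a`, `b`, `c`. -/
def det₃ {R : Type*} [CommRing R] (a b c : Fin 3 → R) : R :=
  a 0 * (b 1 * c 2 - b 2 * c 1) - a 1 * (b 0 * c 2 - b 2 * c 0) + a 2 * (b 0 * c 1 - b 1 * c 0)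

/-- The ternary cubic form with coefficients `c`. -/
def ternaryCubic {R M : Type*} [CommSemiring R] [AddCommMonoid M] [Module R M]
    (c : Fin 10 → M) (x y z : R) : M :=
  x ^ 3 • c 0 + y ^ 3 • c 1 + z ^ 3 • c 2 + (x ^ 2 * y) • c 3 + (x ^ 2 * z) • c 4 +
    (x * y ^ 2) • c 5 + (y ^ 2 * z) • c 6 + (x * z ^ 2) • c 7 + (y * z ^ 2) • c 8 +
    (x * y * z) • c 9

theorem exists_det₃_eq_ternaryCubic {R : Type*} [CommRing R] (a b c : Fin 3 → Fin 3 → R) :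
    ∃ k : Fin 10 → R, ∀ x y z : R,
      det₃ (x • a 0 + y • a 1 + z • a 2) (x • b 0 + y • b 1 + z • b 2)
        (x • c 0 + y • c 1 + z • c 2) = ternaryCubic k x y z := by
  let d (i j l : Fin 3) : R := det₃ (a i) (b j) (c l)
  refine ⟨![d 0 0 0, d 1 1 1, d 2 2 2, d 0 0 1 + d 0 1 0 + d 1 0 0, d 0 0 2 + d 0 2 0 + d 2 0 0,
    d 0 1 1 + d 1 0 1 + d 1 1 0, d 1 1 2 + d 1 2 1 + d 2 1 1, d 0 2 2 + d 2 0 2 + d 2 2 0,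
    d 1 2 2 + d 2 1 2 + d 2 2 1, d 0 1 2 + d 0 2 1 + d 1 0 2 + d 1 2 0 + d 2 0 1 + d 2 1 0],
    fun x y z => ?_⟩
  simp only [d, ternaryCubic, det₃, Pi.add_apply, Pi.smul_apply, smul_eq_mul, Matrix.cons_val]
  ring

theorem exists_ne_zero_ne_one {F : Type*} [Field F] [Fintype F] (hF : 3 ≤ Fintype.card F) :
    ∃ t : F, t ≠ 0 ∧ t ≠ 1 := by
  classical
  obtain ⟨t, -, ht⟩ := Finset.exists_mem_notMem_of_card_lt_card (s := ({0, 1} : Finset F))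
    (t := Finset.univ) (lt_of_le_of_lt Finset.card_le_two (by rw [Finset.card_univ]; omega))
  exact ⟨t, by simpa using ht⟩

theorem binaryCubic_coeff_eq_zero {F M : Type*} [Field F] [Fintype F] [AddCommGroup M] [Module F M]
    (hF : 3 ≤ Fintype.card F) {a b c d : M}
    (h : ∀ y z : F, y ^ 3 • a + (y ^ 2 * z) • b + (y * z ^ 2) • c + z ^ 3 • d = 0) :
    a = 0 ∧ b = 0 ∧ c = 0 ∧ d = 0 := by
  have ha : a = 0 := by simpa using h 1 0
  have hd : d = 0 := by simpa using h 0 1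
  subst ha hd
  obtain ⟨t, ht0, ht1⟩ := exists_ne_zero_ne_one hF
  have h1 : b + c = 0 := by simpa using h 1 1
  have ht : t • b + t ^ 2 • c = 0 := by simpa using h 1 t
  have hb : b = -c := eq_neg_of_add_eq_zero_left h1
  have hc : (t * (t - 1)) • c = 0 := by
    rw [← ht, hb]; module
  have hc0 : c = 0 := (smul_eq_zero.1 hc).resolve_left (mul_ne_zero ht0 (sub_ne_zero.2 ht1))
  simp [hb, hc0]

theorem ternaryCubic_coeff_eq_zero {F M : Type*} [Field F] [Fintype F] [AddCommGroup M]
    [Module F M] (hF : 3 ≤ Fintype.card F) {c : Fin 10 → M}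
    (hx : ∀ y z : F, ternaryCubic c 0 y z = 0) (hy : ∀ x z : F, ternaryCubic c x 0 z = 0) :
    ∀ i, i ≠ 3 → i ≠ 5 → i ≠ 9 → c i = 0 := by
  obtain ⟨h1, h6, h8, h2⟩ := binaryCubic_coeff_eq_zero (a := c 1) (b := c 6) (c := c 8) (d := c 2)
    hF fun y z => by rw [← hx y z]; simp only [ternaryCubic]; module
  obtain ⟨h0, h4, h7, -⟩ := binaryCubic_coeff_eq_zero (a := c 0) (b := c 4) (c := c 7) (d := c 2)
    hF fun x z => by rw [← hy x z]; simp only [ternaryCubic]; module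
  intro i
  fin_cases i <;> simp [*]

theorem ternaryCubic_eq_of_coeff_eq_zero {R M : Type*} [CommRing R] [AddCommGroup M]
    [Module R M] {c : Fin 10 → M} (hc : ∀ i, i ≠ 3 → i ≠ 5 → i ≠ 9 → c i = 0) (x y z : R) :
    ternaryCubic c x y z = (x * y) • (x • c 3 + y • c 5 + z • c 9) := by
  have h0 := hc 0 (by decide) (by decide) (by decide)
  have h1 := hc 1 (by decide) (by decide) (by decide)
  have h2 := hc 2 (by decide) (by decide) (by decide)
  have h4 := hc 4 (by decide) (by decide) (by decide)
  have h6 := hc 6 (by decide) (by decide) (by decide)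
  have h7 := hc 7 (by decide) (by decide) (by decide)
  have h8 := hc 8 (by decide) (by decide) (by decide)
  simp only [ternaryCubic, h0, h1, h2, h4, h6, h7, h8]
  module

/-- A polynomial of degree at most `n` over an extension has at most `n` zeros in the base field. -/
theorem card_filter_aeval_eq_zero_le {F L : Type*} [Field F] [Fintype F] [DecidableEq L]
    [Field L] [Algebra F L] {p : Polynomial L} (hp : p ≠ 0) {n : ℕ} (hn : p.natDegree ≤ n) :
    (Finset.univ.filter fun t : F => p.eval (algebraMap F L t) = 0).card ≤ n := by
  refine le_trans ?_ hn
  rw [← Finset.card_image_of_injective _ (algebraMap F L).injective]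
  refine Polynomial.card_le_degree_of_subset_roots fun x hx => ?_
  simp only [Finset.image_val, Multiset.mem_dedup, Multiset.mem_map, Finset.mem_val,
    Finset.mem_filter, Finset.mem_univ, true_and] at hx
  obtain ⟨t, ht, rfl⟩ := hx
  exact (Polynomial.mem_roots hp).2 ht

theorem card_filter_cubic_eq_zero_le {F L : Type*} [Field F] [Fintype F] [DecidableEq L]
    [Field L] [Algebra F L] {a : L} (ha : a ≠ 0) (b c d : L) :
    (Finset.univ.filter fun t : F => t ^ 3 • a + t ^ 2 • b + t • c + d = 0).card ≤ 3 := by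
  have hp : Polynomial.C a * Polynomial.X ^ 3 + Polynomial.C b * Polynomial.X ^ 2 +
      Polynomial.C c * Polynomial.X + Polynomial.C d ≠ 0 := fun h => ha <| by
    simpa [Polynomial.coeff_X, Polynomial.coeff_C] using congrArg (Polynomial.coeff · 3) h
  have heval (t : F) : t ^ 3 • a + t ^ 2 • b + t • c + d = (Polynomial.C a * Polynomial.X ^ 3 +
      Polynomial.C b * Polynomial.X ^ 2 + Polynomial.C c * Polynomial.X +
      Polynomial.C d).eval (algebraMap F L t) := by
    simp only [Algebra.smul_def, map_pow, Polynomial.eval_add, Polynomial.eval_mul,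
      Polynomial.eval_pow, Polynomial.eval_X, Polynomial.eval_C]
    ring
  simp only [heval]
  exact card_filter_aeval_eq_zero_le hp Polynomial.natDegree_cubic_le

theorem card_filter_quadratic_eq_zero_le {F : Type*} [Field F] [Fintype F] [DecidableEq F]
    {a b c : F} (h : a ≠ 0 ∨ b ≠ 0 ∨ c ≠ 0) :
    (Finset.univ.filter fun t : F => t ^ 2 * a + t * b + c = 0).card ≤ 2 := by
  have hp : Polynomial.C a * Polynomial.X ^ 2 + Polynomial.C b * Polynomial.X +
      Polynomial.C c ≠ 0 := fun h' => by
    have h2 : a = 0 := by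
      simpa [Polynomial.coeff_X, Polynomial.coeff_C] using congrArg (Polynomial.coeff · 2) h'
    have h1 : b = 0 := by
      simpa [Polynomial.coeff_X, Polynomial.coeff_C] using congrArg (Polynomial.coeff · 1) h'
    have h0 : c = 0 := by
      simpa [Polynomial.coeff_X, Polynomial.coeff_C] using congrArg (Polynomial.coeff · 0) h'
    simp_all
  have heval (t : F) : t ^ 2 * a + t * b + c = (Polynomial.C a * Polynomial.X ^ 2 +
      Polynomial.C b * Polynomial.X + Polynomial.C c).eval (algebraMap F F t) := by
    simp only [Algebra.algebraMap_self, RingHom.id_apply, Polynomial.eval_add, Polynomial.eval_mul,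
      Polynomial.eval_pow, Polynomial.eval_X, Polynomial.eval_C]
    ring
  simp only [heval]
  exact card_filter_aeval_eq_zero_le hp Polynomial.natDegree_quadratic_le

theorem card_filter_linear_eq_zero_le {F : Type*} [Field F] [Fintype F] [DecidableEq F]
    {b c : F} (h : b ≠ 0 ∨ c ≠ 0) :
    (Finset.univ.filter fun t : F => t * b + c = 0).card ≤ 1 := by
  refine Finset.card_le_one.2 fun s hs t ht => ?_
  simp only [Finset.mem_filter, Finset.mem_univ, true_and] at hs ht
  have hb : b ≠ 0 := by
    rintro rfl
    simp_all
  exact mul_right_cancel₀ hb (by linear_combination hs - ht)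

/-- A line of the affine plane over `F`, with coefficients in an extension, has at most `|F|`
points over `F`. -/
theorem card_filter_affine_eq_zero_le {F L : Type*} [Field F] [Fintype F] [DecidableEq L]
    [Field L] [Algebra F L] {a b c : L} (h : a ≠ 0 ∨ b ≠ 0 ∨ c ≠ 0) :
    (Finset.univ.filter fun p : F × F => a + p.1 • b + p.2 • c = 0).card ≤ Fintype.card F := by
  by_cases hc : c = 0
  · refine Finset.card_le_card_of_injOn Prod.snd (by simp) fun p hp p' hp' hpp => ?_
    simp only [Finset.coe_filter, Finset.mem_univ, true_and, Set.mem_ofPred_eq] at hp hp'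
    have hb : b ≠ 0 := by
      rintro rfl
      simp_all
    refine Prod.ext (smul_left_injective F hb ?_) hpp
    simp only [hc, smul_zero, add_zero] at hp hp'
    simpa using hp.trans hp'.symm
  · refine Finset.card_le_card_of_injOn Prod.fst (by simp) fun p hp p' hp' hpp => ?_
    simp only [Finset.coe_filter, Finset.mem_univ, true_and, Set.mem_ofPred_eq] at hp hp'
    refine Prod.ext hpp (smul_left_injective F hc ?_)
    rw [hpp] at hp
    simpa using hp.trans hp'.symm

/-- Any point of a line of the projective plane is a combination of two given affine points. -/
theorem exists_combination_of_collinear {K : Type*} [Field K] {k l m a b c y z y' z' : K}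
    (hklm : k ≠ 0 ∨ l ≠ 0 ∨ m ≠ 0) (h : k + y * l + z * m = 0) (h' : k + y' * l + z' * m = 0)
    (habc : a * k + b * l + c * m = 0) (hne : ¬ (y = y' ∧ z = z')) :
    ∃ s t : K, s + t = a ∧ s * y + t * y' = b ∧ s * z + t * z' = c := by
  have hlm : l ≠ 0 ∨ m ≠ 0 := by
    by_contra! hlm
    simp_all
  have hdet : (b - a * y) * (z' - z) = (c - a * z) * (y' - y) := by
    rcases hlm with hl | hm
    · refine mul_left_cancel₀ hl ?_
      linear_combination (z' - z) * (habc - a * h) - (c - a * z) * (h' - h)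
    · refine mul_left_cancel₀ hm ?_
      linear_combination -(y' - y) * (habc - a * h) + (b - a * y) * (h' - h)
  by_cases hy : y = y'
  · have hz : z' - z ≠ 0 := sub_ne_zero.2 fun hz => hne ⟨hy, hz.symm⟩
    subst hy
    refine ⟨a - (c - a * z) / (z' - z), (c - a * z) / (z' - z), by ring, ?_, ?_⟩
    · have := (mul_eq_zero.1 (hdet.trans (by ring))).resolve_right hz
      linear_combination -this
    · field_simp
      ring
  · have hy : y' - y ≠ 0 := sub_ne_zero.2 (Ne.symm hy)
    refine ⟨a - (b - a * y) / (y' - y), (b - a * y) / (y' - y), by ring, ?_, ?_⟩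
    · field_simp
      ring
    · field_simp
      linear_combination hdet

section Points

variable {F L E : Type*} [Field F] [Field L] [Algebra F L] [AddCommGroup E]
  [Module F E] [Module L E] [IsScalarTower F L E]

/-- The points of the projective space of `E` over `L` that are spanned by a vector of `Z`. -/
def pointsOf (L : Type*) {E : Type*} [Field L] [AddCommGroup E] [Module L E] (Z : Set E) :
    Set (Submodule L E) :=
  {p | ∃ w ∈ Z, w ≠ 0 ∧ p = Submodule.span L {w}}

theorem pointsOf_mono {Z Z' : Set E} (h : Z ⊆ Z') : pointsOf L Z ⊆ pointsOf L Z' :=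
  fun _ ⟨w, hw, hw0, hp⟩ => ⟨w, h hw, hw0, hp⟩

theorem span_singleton_base_smul {a : F} (ha : a ≠ 0) (w : E) :
    Submodule.span L {a • w} = Submodule.span L {w} := by
  rw [← algebraMap_smul L a w]
  exact Submodule.span_singleton_smul_eq (by simpa using ha) w

theorem span_singleton_eq_of_relation {v w : E} (hv : v ≠ 0) (hw : w ≠ 0) {a b : L}
    (hab : a ≠ 0 ∨ b ≠ 0) (h : a • v + b • w = 0) :
    Submodule.span L {v} = Submodule.span L {w} := by
  have ha : a ≠ 0 := by
    rintro rfl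
    simp_all
  have hb : b ≠ 0 := by
    rintro rfl
    simp_all
  refine Submodule.span_singleton_eq_span_singleton.2 ⟨.mk0 (-(b⁻¹ * a))
    (neg_ne_zero.2 (mul_ne_zero (inv_ne_zero hb) ha)), ?_⟩
  rw [Units.smul_mk0, neg_smul, mul_smul, eq_neg_of_add_eq_zero_left h, smul_neg, smul_smul,
    inv_mul_cancel₀ hb, one_smul, neg_neg]

theorem ncard_le_card_of_subset {α : Type*} {S : Set α} {t : Finset α} (h : S ⊆ ↑t) :
    S.ncard ≤ t.card :=
  (Set.ncard_le_ncard h).trans_eq (Set.ncard_coe_finset t)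

theorem exists_pair_of_finrank_eq_two {W : Submodule F E} (hW : finrank F W = 2) {w : E}
    (hw : w ∈ W) (hw0 : w ≠ 0) :
    ∃ v ∈ W, ∀ u ∈ W, ∃ x y : F, u = x • v + y • w := by
  have : FiniteDimensional F W := .of_finrank_pos (by omega)
  have hle : ¬ W ≤ Submodule.span F {w} := fun h => by
    have := Submodule.finrank_mono h
    rw [hW, finrank_span_singleton hw0] at this
    omega
  obtain ⟨v, hv, hvw⟩ := SetLike.not_le_iff_exists.1 hle
  have hlt : Submodule.span F {w} < Submodule.span F {v, w} := by
    refine lt_of_le_of_ne (Submodule.span_mono (by simp)) fun h => hvw ?_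
    rw [h]
    exact Submodule.subset_span (by simp)
  have hsub : Submodule.span F {v, w} ≤ W := by
    rw [Submodule.span_le]
    rintro _ (rfl | rfl)
    exacts [hv, hw]
  have : FiniteDimensional F (Submodule.span F {v, w}) := Submodule.finiteDimensional_of_le hsub
  have hfin := Submodule.finrank_lt_finrank_of_lt hlt
  rw [finrank_span_singleton hw0] at hfin
  have heq := Submodule.eq_of_le_of_finrank_le hsub (by omega)
  refine ⟨v, hv, fun u hu => ?_⟩
  rw [← heq] at hu
  obtain ⟨x, y, h⟩ := Submodule.mem_span_pair.1 hu
  exact ⟨x, y, h.symm⟩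

/-- Normal form for the points of the line through `v` and `w`. -/
theorem span_singleton_pair (x y : F) (v w : E) (h : x • v + y • w ≠ 0) :
    (x = 0 ∧ Submodule.span L {x • v + y • w} = Submodule.span L {w}) ∨
    (x ≠ 0 ∧ x • v + y • w = x • (v + (x⁻¹ * y) • w) ∧
      Submodule.span L {x • v + y • w} = Submodule.span L {v + (x⁻¹ * y) • w}) := by
  by_cases hx : x = 0
  · subst hx
    have hy : y ≠ 0 := by
      rintro rfl
      simp at h
    exact Or.inl ⟨rfl, by rw [zero_smul, zero_add, span_singleton_base_smul hy]⟩
  · have heq : x • v + y • w = x • (v + (x⁻¹ * y) • w) := by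
      rw [smul_add, smul_smul, mul_inv_cancel_left₀ hx]
    exact Or.inr ⟨hx, heq, by rw [heq, span_singleton_base_smul hx]⟩

theorem ncard_pointsOf_line_le [Fintype F] {W : Submodule F E} (hW : finrank F W = 2) :
    (pointsOf L (W : Set E)).ncard ≤ Fintype.card F + 1 := by
  classical
  obtain ⟨w, hw, hw0⟩ := Submodule.exists_mem_ne_zero_of_ne_bot (p := W) (by
    rintro rfl
    simp at hW)
  obtain ⟨v, -, hvw⟩ := exists_pair_of_finrank_eq_two hW hw hw0
  refine (ncard_le_card_of_subset (t := insert (Submodule.span L {w})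
    (Finset.univ.image fun t : F => Submodule.span L {v + t • w})) ?_).trans
    ((Finset.card_insert_le _ _).trans (Nat.add_le_add_right Finset.card_image_le 1))
  rintro p ⟨u, hu, hu0, rfl⟩
  obtain ⟨x, y, rfl⟩ := hvw u hu
  rcases span_singleton_pair (L := L) x y v w hu0 with ⟨-, h⟩ | ⟨-, -, h⟩ <;> simp [h]

end Points

section CubicMap

variable {F L E : Type*} [Field F] [Field L] [Algebra F L] [AddCommGroup E] [Module F E]

/-- The cubic map `w ↦ det (g₀ w, g₁ w, g₂ w)`. -/
def cubicMap (g : Fin 3 → E →ₗ[F] (Fin 3 → L)) (w : E) : L :=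
  det₃ (g 0 w) (g 1 w) (g 2 w)

/-- The polar form of `cubicMap g` at `p`, linear in the second argument. -/
def cubicPolar (g : Fin 3 → E →ₗ[F] (Fin 3 → L)) (p : E) : E →ₗ[F] L where
  toFun r := det₃ (g 0 r) (g 1 p) (g 2 p) + det₃ (g 0 p) (g 1 r) (g 2 p) +
    det₃ (g 0 p) (g 1 p) (g 2 r)
  map_add' r s := by
    simp only [det₃, map_add, Pi.add_apply]
    ring
  map_smul' a r := by
    simp only [det₃, map_smul, Pi.smul_apply, Algebra.smul_def, RingHom.id_apply]
    ring

variable (g : Fin 3 → E →ₗ[F] (Fin 3 → L))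

theorem cubicMap_smul (a : F) (w : E) : cubicMap g (a • w) = a ^ 3 • cubicMap g w := by
  simp only [cubicMap, det₃, map_smul, Pi.smul_apply, Algebra.smul_def, map_pow]
  ring

theorem cubicMap_smul_add (s : F) (p r : E) :
    cubicMap g (s • p + r) =
      s ^ 3 • cubicMap g p + s ^ 2 • cubicPolar g p r + s • cubicPolar g r p + cubicMap g r := by
  simp only [cubicMap, cubicPolar, det₃, LinearMap.coe_mk, AddHom.coe_mk, map_add, map_smul,
    Pi.add_apply, Pi.smul_apply]
  simp only [Algebra.smul_def, map_pow]
  ring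

theorem cubicPolar_smul_left (a : F) (p r : E) :
    cubicPolar g (a • p) r = a ^ 2 • cubicPolar g p r := by
  simp only [cubicPolar, det₃, LinearMap.coe_mk, AddHom.coe_mk, map_smul, Pi.smul_apply]
  simp only [Algebra.smul_def, map_pow]
  ring

variable [Module L E]

/-- In coordinates `cubicMap g` is a ternary cubic form, which also vanishes at the linear relations
over `L` among the coordinate vectors if `g 0` is linear over `L`. -/
theorem exists_cubicMap_eq_ternaryCubic (hg : ∀ (a : L) (w : E), g 0 (a • w) = a • g 0 w)
    (v : Fin 3 → E) :
    ∃ k : Fin 10 → L,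
      (∀ x y z : F, cubicMap g (x • v 0 + y • v 1 + z • v 2) = ternaryCubic k x y z) ∧
      ∀ x y z : L, x • v 0 + y • v 1 + z • v 2 = 0 → ternaryCubic k x y z = 0 := by
  obtain ⟨k, hk⟩ := exists_det₃_eq_ternaryCubic (fun i => g 0 (v i)) (fun i => g 1 (v i))
    (fun i => g 2 (v i))
  refine ⟨k, fun x y z => ?_, fun x y z h => ?_⟩
  · have := hk (algebraMap F L x) (algebraMap F L y) (algebraMap F L z)
    simp only [ternaryCubic, algebraMap_smul, ← map_pow, ← map_mul] at this
    rw [ternaryCubic, ← this, cubicMap]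
    simp only [map_add, map_smul]
  · rw [← hk x y z, ← hg, ← hg, ← hg, ← map_add, ← map_add, h, map_zero]
    simp [det₃]

/-- A line on which the cubic does not vanish has at most three points on it. -/
theorem ncard_pointsOf_line_cubicMap_le [IsScalarTower F L E] [Fintype F]
    {W : Submodule F E} (hW : finrank F W = 2) {w : E} (hw : w ∈ W) (hw0 : cubicMap g w ≠ 0) :
    (pointsOf L {u | u ∈ W ∧ cubicMap g u = 0}).ncard ≤ 3 := by
  classical
  obtain ⟨v, -, hvw⟩ := exists_pair_of_finrank_eq_two hW hw (by
    rintro rfl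
    simp [cubicMap, det₃] at hw0)
  refine (ncard_le_card_of_subset (t := (Finset.univ.filter fun t : F =>
    t ^ 3 • cubicMap g w + t ^ 2 • cubicPolar g w v + t • cubicPolar g v w +
      cubicMap g v = 0).image fun t : F => Submodule.span L {t • w + v}) ?_).trans
    (Finset.card_image_le.trans (card_filter_cubic_eq_zero_le hw0 _ _ _))
  rintro p ⟨u, ⟨hu, hfu⟩, hu0, rfl⟩
  obtain ⟨x, y, rfl⟩ := hvw u hu
  rcases span_singleton_pair (L := L) x y v w hu0 with ⟨rfl, -⟩ | ⟨hx, heq, h⟩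
  · rw [zero_smul, zero_add] at hfu hu0
    rw [cubicMap_smul, smul_eq_zero] at hfu
    rcases hfu with hy | hy
    · simp [eq_zero_of_pow_eq_zero hy] at hu0
    · exact absurd hy hw0
  · rw [heq, cubicMap_smul, smul_eq_zero] at hfu
    have hfu := hfu.resolve_left (pow_ne_zero 3 hx)
    rw [add_comm, cubicMap_smul_add] at hfu
    rw [h, Finset.coe_image]
    exact ⟨x⁻¹ * y, by simpa using hfu, by rw [add_comm]⟩


theorem exists_coords_of_linearIndependent {U : Submodule F E} (hU : finrank F U = 3)
    {v : Fin 3 → E} (hv : ∀ i, v i ∈ U) (hli : LinearIndependent F v) {w : E} (hw : w ∈ U) :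
    ∃ x y z : F, w = x • v 0 + y • v 1 + z • v 2 := by
  have : FiniteDimensional F U := .of_finrank_pos (by omega)
  have heq : Submodule.span F (Set.range v) = U :=
    Submodule.eq_of_le_of_finrank_eq (Submodule.span_le.2 (Set.range_subset_iff.2 hv))
      (by rw [finrank_span_eq_card hli, hU, Fintype.card_fin])
  rw [← heq, Submodule.mem_span_range_iff_exists_fun] at hw
  obtain ⟨c, rfl⟩ := hw
  exact ⟨c 0, c 1, c 2, Fin.sum_univ_three _⟩

theorem linearIndependent_fin_three_iff {v : Fin 3 → E} :
    LinearIndependent F v ↔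
      ∀ x y z : F, x • v 0 + y • v 1 + z • v 2 = 0 → x = 0 ∧ y = 0 ∧ z = 0 := by
  rw [Fintype.linearIndependent_iff]
  refine ⟨fun h x y z hxyz => ?_, fun h c hc => ?_⟩
  · have := h ![x, y, z] (by simpa [Fin.sum_univ_three] using hxyz)
    exact ⟨this 0, this 1, this 2⟩
  · rw [Fin.sum_univ_three] at hc
    obtain ⟨h0, h1, h2⟩ := h _ _ _ hc
    intro i
    fin_cases i <;> assumption

/-- Two distinct lines of a projective plane are coordinate lines of some frame. -/
theorem exists_frame_of_lines {U W W' : Submodule F E} (hU : finrank F U = 3) (hWU : W ≤ U)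
    (hW'U : W' ≤ U) (hW : finrank F W = 2) (hW' : finrank F W' = 2) (hne : W ≠ W') :
    ∃ v : Fin 3 → E, LinearIndependent F v ∧ (∀ i, v i ∈ U) ∧
      v 1 ∈ W ∧ v 2 ∈ W ∧ v 0 ∈ W' ∧ v 2 ∈ W' := by
  have : FiniteDimensional F U := .of_finrank_pos (by omega)
  have : FiniteDimensional F W := .of_finrank_pos (by omega)
  have : FiniteDimensional F W' := .of_finrank_pos (by omega)
  have hsup : finrank F ↥(W ⊔ W') ≤ 3 := hU ▸ Submodule.finrank_mono (sup_le hWU hW'U)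
  have hadd := Submodule.finrank_sup_add_finrank_inf_eq W W'
  obtain ⟨c, ⟨hcW, hcW'⟩, hc0⟩ := Submodule.exists_mem_ne_zero_of_ne_bot (p := W ⊓ W') (by
    intro h
    rw [h, finrank_bot] at hadd
    omega)
  obtain ⟨b, hbW, hbW'⟩ := SetLike.not_le_iff_exists.1 fun h : W ≤ W' =>
    hne (Submodule.eq_of_le_of_finrank_eq h (hW.trans hW'.symm))
  obtain ⟨a, haW', haW⟩ := SetLike.not_le_iff_exists.1 fun h : W' ≤ W =>
    hne (Submodule.eq_of_le_of_finrank_eq h (hW'.trans hW.symm)).symm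
  refine ⟨![a, b, c], linearIndependent_fin_three_iff.2 fun x y z h => ?_, fun i => ?_,
    hbW, hcW, haW', hcW'⟩
  · simp only [Matrix.cons_val] at h
    have hx : x = 0 := by
      by_contra hx
      refine haW ((W.smul_mem_iff hx).1 ?_)
      rw [add_assoc] at h
      rw [eq_neg_of_add_eq_zero_left h]
      exact W.neg_mem (W.add_mem (W.smul_mem _ hbW) (W.smul_mem _ hcW))
    subst hx
    rw [zero_smul, zero_add] at h
    have hy : y = 0 := by
      by_contra hy
      refine hbW' ((W'.smul_mem_iff hy).1 ?_)
      rw [eq_neg_of_add_eq_zero_left h]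
      exact W'.neg_mem (W'.smul_mem _ hcW')
    subst hy
    rw [zero_smul, zero_add] at h
    exact ⟨rfl, rfl, (smul_eq_zero.1 h).resolve_right hc0⟩
  · fin_cases i
    exacts [hW'U haW', hWU hbW, hWU hcW]

variable [IsScalarTower F L E] [Fintype F]

/-- If some point `p` of the cubic lies on no line of the cubic `φ ∘ cubicMap g`, then counting
along the lines through `p` bounds the number of points. -/
theorem ncard_pointsOf_le_of_point {U : Submodule F E} (hU : finrank F U = 3) (φ : Dual F L)
    {p : E} (hpU : p ∈ U) (hp0 : p ≠ 0) (hfp : cubicMap g p = 0)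
    (hline : ∀ r ∈ U, r ∉ Submodule.span F {p} → ∃ s t : F, φ (cubicMap g (s • p + t • r)) ≠ 0) :
    (pointsOf L {u | u ∈ U ∧ cubicMap g u = 0}).ncard ≤ 2 * Fintype.card F + 2 := by
  classical
  have : FiniteDimensional F U := .of_finrank_pos (by omega)
  let T : U →ₗ[F] F := (φ ∘ₗ cubicPolar g p) ∘ₗ U.subtype
  let A (r : E) : Finset F := Finset.univ.filter fun s : F =>
    s ^ 2 * φ (cubicPolar g p r) + s * φ (cubicPolar g r p) + φ (cubicMap g r) = 0
  have hA (s : F) (r : E) (h : cubicMap g (s • p + r) = 0) : s ∈ A r := by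
    rw [cubicMap_smul_add, hfp] at h
    simpa [A] using congrArg φ h
  have hcoef (r : E) (hr : r ∈ U) (hrp : r ∉ Submodule.span F {p}) :
      φ (cubicPolar g p r) ≠ 0 ∨ φ (cubicPolar g r p) ≠ 0 ∨ φ (cubicMap g r) ≠ 0 := by
    by_contra! h
    obtain ⟨s, t, hst⟩ := hline r hr hrp
    refine hst ?_
    rw [cubicMap_smul_add, hfp, map_smul, cubicPolar_smul_left, cubicMap_smul]
    simp [h.1, h.2.1, h.2.2]
  -- a tangent direction at `p`
  obtain ⟨c, hcU, hTc, hcp⟩ : ∃ c ∈ U, φ (cubicPolar g p c) = 0 ∧ c ∉ Submodule.span F {p} := by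
    have hrank := LinearMap.finrank_range_add_finrank_ker T
    have hrange : finrank F (LinearMap.range T) ≤ 1 :=
      (Submodule.finrank_le _).trans_eq (finrank_self F)
    have hnle : ¬ LinearMap.ker T ≤ Submodule.span F {(⟨p, hpU⟩ : U)} := fun h => by
      have := Submodule.finrank_mono h
      rw [finrank_span_singleton (by simpa using hp0)] at this
      omega
    obtain ⟨c, hc, hcp⟩ := SetLike.not_le_iff_exists.1 hnle
    refine ⟨c, c.2, hc, fun h => hcp ?_⟩
    obtain ⟨a, ha⟩ := Submodule.mem_span_singleton.1 h
    exact Submodule.mem_span_singleton.2 ⟨a, Subtype.ext ha⟩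
  obtain ⟨b, hbU, hbpc⟩ : ∃ b ∈ U, b ∉ Submodule.span F {p, c} := by
    refine SetLike.not_le_iff_exists.1 fun h => ?_
    have : FiniteDimensional F (Submodule.span F {p, c}) :=
      FiniteDimensional.span_of_finite F (Set.toFinite _)
    have h3 := Submodule.finrank_mono h
    have h2 : finrank F (Submodule.span F (({p, c} : Finset E) : Set E)) ≤ _ :=
      finrank_span_finset_le_card _
    rw [Finset.coe_pair] at h2
    have := Finset.card_le_two (a := p) (b := c)
    omega
  have hbp (t : F) : b + t • c ∉ Submodule.span F {p} := fun h => by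
    obtain ⟨a, ha⟩ := Submodule.mem_span_singleton.1 h
    exact hbpc (Submodule.mem_span_pair.2 ⟨a, -t, by rw [ha]; module⟩)
  have hli : LinearIndependent F ![p, b, c] := linearIndependent_fin_three_iff.2 fun x y z h => by
    simp only [Matrix.cons_val] at h
    have hy : y = 0 := by
      by_contra hy
      refine hbpc (((Submodule.span F {p, c}).smul_mem_iff hy).1 ?_)
      exact Submodule.mem_span_pair.2 ⟨-x, -z, by linear_combination (norm := module) (-1 : F) • h⟩
    subst hy
    rw [zero_smul, add_zero] at h
    have hz : z = 0 := by
      by_contra hz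
      refine hcp (((Submodule.span F {p}).smul_mem_iff hz).1 ?_)
      exact Submodule.mem_span_singleton.2 ⟨-x, by linear_combination (norm := module) (-1 : F) • h⟩
    subst hz
    rw [zero_smul, add_zero] at h
    exact ⟨(smul_eq_zero.1 h).resolve_right hp0, rfl, rfl⟩
  let S (r : E) : Finset (Submodule L E) := (A r).image fun s => Submodule.span L {s • p + r}
  have hSb (t : F) : (S (b + t • c)).card ≤ 2 := Finset.card_image_le.trans
    (card_filter_quadratic_eq_zero_le
      (hcoef _ (U.add_mem hbU (U.smul_mem t hcU)) (hbp t)))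
  have hSc : (S c).card ≤ 1 := by
    refine Finset.card_image_le.trans ?_
    simp only [A, hTc, mul_zero, zero_add]
    exact card_filter_linear_eq_zero_le ((hcoef c hcU hcp).resolve_left (not_not.2 hTc))
  have hsub : pointsOf L {u | u ∈ U ∧ cubicMap g u = 0} ⊆
      ↑(insert (Submodule.span L {p}) (S c ∪ Finset.univ.biUnion fun t : F => S (b + t • c))) := by
    rintro _ ⟨u, ⟨hu, hfu⟩, hu0, rfl⟩
    obtain ⟨x, y, z, rfl⟩ := exists_coords_of_linearIndependent hU (v := ![p, b, c])
      (by intro i; fin_cases i; exacts [hpU, hbU, hcU]) hli hu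
    simp only [Matrix.cons_val] at hfu hu0 ⊢
    have key (a : F) (ha : a ≠ 0) (r : E) (s : F) (h : x • p + y • b + z • c = a • (s • p + r)) :
        Submodule.span L {x • p + y • b + z • c} ∈ S r := by
      rw [h, cubicMap_smul] at hfu
      rw [h, span_singleton_base_smul ha]
      exact Finset.mem_image_of_mem _
        (hA _ _ ((smul_eq_zero.1 hfu).resolve_left (pow_ne_zero 3 ha)))
    simp only [Finset.coe_insert, Set.mem_insert_iff, Finset.mem_coe, Finset.mem_union,
      Finset.mem_biUnion, Finset.mem_univ, true_and]
    by_cases hy : y = 0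
    · by_cases hz : z = 0
      · subst hy hz
        left
        simp only [zero_smul, add_zero] at hu0 ⊢
        refine span_singleton_base_smul ?_ p
        rintro rfl
        simp at hu0
      · refine Or.inr (Or.inl (key z hz c (z⁻¹ * x) ?_))
        rw [hy, smul_add, smul_smul, mul_inv_cancel_left₀ hz]
        module
    · refine Or.inr (Or.inr ⟨y⁻¹ * z, key y hy _ (y⁻¹ * x) ?_⟩)
      rw [smul_add, smul_add, smul_smul, smul_smul, mul_inv_cancel_left₀ hy,
        mul_inv_cancel_left₀ hy]
      module
  refine (ncard_le_card_of_subset hsub).trans ?_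
  have h1 := Finset.card_insert_le (Submodule.span L {p})
    (S c ∪ Finset.univ.biUnion fun t : F => S (b + t • c))
  have h2 := Finset.card_union_le (S c) (Finset.univ.biUnion fun t : F => S (b + t • c))
  have h3 := Finset.card_biUnion_le_card_mul Finset.univ (fun t : F => S (b + t • c)) 2
    fun t _ => hSb t
  rw [Finset.card_univ] at h3
  omega

/-- The bound when the cubic contains two lines: then it is the product of two linear forms over `F`
and one over `L`, and the linear relation over `L` between the vectors of a frame is a zero of one
of them. -/
theorem ncard_pointsOf_le_of_two_lines (hF : 3 ≤ Fintype.card F) (hE : finrank L E = 2)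
    (hg : ∀ (a : L) (w : E), g 0 (a • w) = a • g 0 w) {U W W' : Submodule F E}
    (hU : finrank F U = 3) (hWU : W ≤ U) (hW'U : W' ≤ U) (hW : finrank F W = 2)
    (hW' : finrank F W' = 2) (hne : W ≠ W') (hfW : ∀ w ∈ W, cubicMap g w = 0)
    (hfW' : ∀ w ∈ W', cubicMap g w = 0) (hf : ∃ w ∈ U, cubicMap g w ≠ 0) :
    (pointsOf L {u | u ∈ U ∧ cubicMap g u = 0}).ncard ≤ 2 * Fintype.card F + 2 := by
  classical
  obtain ⟨v, hli, hvU, h1W, h2W, h0W', h2W'⟩ :=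
    exists_frame_of_lines hU hWU hW'U hW hW' hne
  have hv0 (x y z : F) (h : x ≠ 0 ∨ y ≠ 0 ∨ z ≠ 0) : x • v 0 + y • v 1 + z • v 2 ≠ 0 := fun h' => by
    have := linearIndependent_fin_three_iff.1 hli x y z h'
    tauto
  obtain ⟨k, hk, hkL⟩ := exists_cubicMap_eq_ternaryCubic g hg v
  have hcoef := ternaryCubic_coeff_eq_zero (F := F) (c := k) hF
    (fun y z => by
      rw [← hk, zero_smul, zero_add]
      exact hfW _ (W.add_mem (W.smul_mem _ h1W) (W.smul_mem _ h2W)))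
    (fun x z => by
      rw [← hk, zero_smul, add_zero]
      exact hfW' _ (W'.add_mem (W'.smul_mem _ h0W') (W'.smul_mem _ h2W')))
  simp only [ternaryCubic_eq_of_coeff_eq_zero hcoef] at hk hkL
  have hk0 : k 3 ≠ 0 ∨ k 5 ≠ 0 ∨ k 9 ≠ 0 := by
    by_contra! h
    obtain ⟨w, hw, hfw⟩ := hf
    obtain ⟨x, y, z, rfl⟩ := exists_coords_of_linearIndependent hU hvU hli hw
    simp [hk, h] at hfw
  let J : Finset (F × F) := Finset.univ.filter fun t => k 3 + t.1 • k 5 + t.2 • k 9 = 0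
  let pJ (t : F × F) : Submodule L E := Submodule.span L {v 0 + t.1 • v 1 + t.2 • v 2}
  have hJ : (J.image pJ).card ≤ Fintype.card F :=
    Finset.card_image_le.trans (card_filter_affine_eq_zero_le hk0)
  let A : Finset (Submodule L E) := Finset.univ.image fun t : F => Submodule.span L {v 1 + t • v 2}
  let A' : Finset (Submodule L E) := Finset.univ.image fun t : F => Submodule.span L {v 0 + t • v 2}
  have hA : A.card ≤ Fintype.card F := Finset.card_image_le
  have hA' : A'.card ≤ Fintype.card F := Finset.card_image_le
  have hsub : pointsOf L {u | u ∈ U ∧ cubicMap g u = 0} ⊆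
      ↑({Submodule.span L {v 2}} ∪ A ∪ A' ∪ J.image pJ) := by
    rintro _ ⟨u, ⟨hu, hfu⟩, hu0, rfl⟩
    obtain ⟨x, y, z, rfl⟩ := exists_coords_of_linearIndependent hU hvU hli hu
    simp only [Finset.coe_union, Finset.coe_singleton, Set.mem_union, Set.mem_singleton_iff,
      Finset.mem_coe]
    by_cases hx : x = 0
    · subst hx
      simp only [zero_smul, zero_add] at hu0 ⊢
      rcases span_singleton_pair (L := L) y z (v 1) (v 2) hu0 with ⟨-, h⟩ | ⟨-, -, h⟩
      · exact Or.inl (Or.inl (Or.inl h))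
      · exact Or.inl (Or.inl (Or.inr (h ▸ Finset.mem_image_of_mem _ (Finset.mem_univ _))))
    by_cases hy : y = 0
    · subst hy
      simp only [zero_smul, add_zero] at hu0 ⊢
      rcases span_singleton_pair (L := L) x z (v 0) (v 2) hu0 with ⟨h, -⟩ | ⟨-, -, h⟩
      · exact absurd h hx
      · exact Or.inl (Or.inr (h ▸ Finset.mem_image_of_mem _ (Finset.mem_univ _)))
    · have heq : x • v 0 + y • v 1 + z • v 2 =
          x • (v 0 + (x⁻¹ * y) • v 1 + (x⁻¹ * z) • v 2) := by
        simp only [smul_add, smul_smul, mul_inv_cancel_left₀ hx]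
      rw [heq, span_singleton_base_smul hx]
      refine Or.inr (Finset.mem_image_of_mem pJ (a := (x⁻¹ * y, x⁻¹ * z)) ?_)
      rw [hk, smul_eq_zero, or_iff_right (mul_ne_zero hx hy)] at hfu
      have hfu' := congrArg (x⁻¹ • ·) hfu
      simpa [J, smul_add, smul_smul, hx] using hfu'
  -- the linear relation over `L` between the vectors of the frame
  obtain ⟨a, b, c, hrel, habc⟩ : ∃ a b c : L, a • v 0 + b • v 1 + c • v 2 = 0 ∧
      (a ≠ 0 ∨ b ≠ 0 ∨ c ≠ 0) := by
    have : FiniteDimensional L E := .of_finrank_pos (by omega)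
    have hdep : ¬ LinearIndependent L v := fun h => by
      have := h.fintype_card_le_finrank
      rw [hE, Fintype.card_fin] at this
      omega
    rw [linearIndependent_fin_three_iff] at hdep
    push Not at hdep
    obtain ⟨a, b, c, h, h'⟩ := hdep
    exact ⟨a, b, c, h, by tauto⟩
  have hcard : ∀ T : Finset (Submodule L E), pointsOf L {u | u ∈ U ∧ cubicMap g u = 0} ⊆ ↑T →
      T.card ≤ 2 * Fintype.card F + 2 →
      (pointsOf L {u | u ∈ U ∧ cubicMap g u = 0}).ncard ≤ 2 * Fintype.card F + 2 :=
    fun T h h' => (ncard_le_card_of_subset h).trans h'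
  have hcollapse (i : Fin 3) (hi : ∀ t : F, v i + t • v 2 ≠ 0) (d : L) (hd : d ≠ 0 ∨ c ≠ 0)
      (h : d • v i + c • v 2 = 0) (t : F) :
      Submodule.span L {v i + t • v 2} = Submodule.span L {v 2} := by
    have hv2 : v 2 ≠ 0 := by simpa using hv0 0 0 1 (by simp)
    refine span_singleton_eq_of_relation (hi t) hv2 (a := d) (b := c - t • d) ?_ ?_
    · by_cases hd0 : d = 0
      · simpa [hd0] using hd
      · exact Or.inl hd0
    · rw [← h, smul_add, sub_smul, smul_comm d t, smul_assoc]
      abel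
  have hzero := hkL a b c hrel
  rw [smul_eq_zero, mul_eq_zero] at hzero
  rcases hzero with (rfl | rfl) | hm
  · have hAsub : A ⊆ {Submodule.span L {v 2}} := by
      refine Finset.image_subset_iff.2 fun t _ => Finset.mem_singleton.2
        (hcollapse 1 (fun t => by simpa using hv0 0 1 t (by simp)) b (by simpa using habc)
          (by simpa using hrel) t)
    rw [Finset.union_eq_left.2 hAsub] at hsub
    refine hcard _ hsub ?_
    have h1 := Finset.card_union_le ({Submodule.span L {v 2}} ∪ A') (J.image pJ)
    have h2 := Finset.card_union_le {Submodule.span L {v 2}} A'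
    rw [Finset.card_singleton] at h2
    omega
  · have hAsub : A' ⊆ {Submodule.span L {v 2}} := by
      refine Finset.image_subset_iff.2 fun t _ => Finset.mem_singleton.2
        (hcollapse 0 (fun t => by simpa using hv0 1 0 t (by simp)) a (by simpa using habc)
          (by simpa using hrel) t)
    rw [Finset.union_eq_left.2 (hAsub.trans Finset.subset_union_left)] at hsub
    refine hcard _ hsub ?_
    have h1 := Finset.card_union_le ({Submodule.span L {v 2}} ∪ A) (J.image pJ)
    have h2 := Finset.card_union_le {Submodule.span L {v 2}} A
    rw [Finset.card_singleton] at h2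
    omega
  · have hJ1 : (J.image pJ).card ≤ 1 := by
      refine Finset.card_le_one.2 fun P hP Q hQ => ?_
      obtain ⟨⟨y, z⟩, ht, rfl⟩ := Finset.mem_image.1 hP
      obtain ⟨⟨y', z'⟩, ht', rfl⟩ := Finset.mem_image.1 hQ
      simp only [J, Finset.mem_filter, Finset.mem_univ, true_and] at ht ht'
      by_cases heq : y = y' ∧ z = z'
      · rw [heq.1, heq.2]
      simp only [Algebra.smul_def] at ht ht'
      obtain ⟨s, t, hs, hy, hz⟩ := exists_combination_of_collinear hk0 ht ht' hm
        (by simpa using heq)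
      refine span_singleton_eq_of_relation (a := s) (b := t)
        (by simpa using hv0 1 y z (by simp)) (by simpa using hv0 1 y' z' (by simp)) ?_ ?_
      · by_contra! hst
        simp [hst.1, hst.2] at hs hy hz
        simp [← hs, ← hy, ← hz] at habc
      · rw [← hrel, ← hs, ← hy, ← hz]
        simp only [← algebraMap_smul L y, ← algebraMap_smul L z, ← algebraMap_smul L y',
          ← algebraMap_smul L z']
        module
    refine hcard _ hsub ?_
    have h1 := Finset.card_union_le ({Submodule.span L {v 2}} ∪ A ∪ A') (J.image pJ)
    have h2 := Finset.card_union_le ({Submodule.span L {v 2}} ∪ A) A'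
    have h3 := Finset.card_union_le {Submodule.span L {v 2}} A
    rw [Finset.card_singleton] at h3
    omega

/-- The number of points spanned by the zeros of a cubic map that does not vanish identically on the
plane `U`, when `g 0` is linear over `L`. -/
theorem ncard_pointsOf_cubicMap_le [Finite E] (hF : 3 ≤ Fintype.card F) (hE : finrank L E = 2)
    (hg : ∀ (a : L) (w : E), g 0 (a • w) = a • g 0 w) {U : Submodule F E}
    (hU : finrank F U = 3) (hf : ∃ w ∈ U, cubicMap g w ≠ 0) :
    (pointsOf L {u | u ∈ U ∧ cubicMap g u = 0}).ncard ≤ 2 * Fintype.card F + 2 ∨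
    (pointsOf L {u | u ∈ U ∧ cubicMap g u = 0}).ncard ≤ Fintype.card F + 7 := by
  obtain ⟨w₀, hw₀U, hw₀⟩ := hf
  obtain ⟨φ, hφ⟩ := Projective.exists_dual_ne_zero F hw₀
  by_cases hpt : ∃ p ∈ U, p ≠ 0 ∧ cubicMap g p = 0 ∧
      ∀ r ∈ U, r ∉ Submodule.span F {p} → ∃ s t : F, φ (cubicMap g (s • p + t • r)) ≠ 0
  · obtain ⟨p, hpU, hp0, hfp, hline⟩ := hpt
    exact Or.inl (ncard_pointsOf_le_of_point g hU φ hpU hp0 hfp hline)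
  push Not at hpt
  -- every point of the cubic lies on a line of the cubic `φ ∘ cubicMap g`
  have hlines (p : E) (hpU : p ∈ U) (hp0 : p ≠ 0) (hfp : cubicMap g p = 0) :
      ∃ W : Submodule F E, W ≤ U ∧ finrank F W = 2 ∧ p ∈ W ∧ ∀ w ∈ W, φ (cubicMap g w) = 0 := by
    obtain ⟨r, hrU, hrp, hr⟩ := hpt p hpU hp0 hfp
    refine ⟨Submodule.span F {p, r}, ?_, ?_, Submodule.subset_span (by simp), fun w hw => ?_⟩
    · rw [Submodule.span_le]
      rintro _ (rfl | rfl)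
      exacts [hpU, hrU]
    · have hli : LinearIndependent F ![p, r] := by
        rw [LinearIndependent.pair_iff' hp0]
        exact fun a ha => hrp (Submodule.mem_span_singleton.2 ⟨a, ha⟩)
      have := finrank_span_eq_card hli
      rwa [Matrix.range_cons_cons_empty, Fintype.card_fin] at this
    · obtain ⟨s, t, rfl⟩ := Submodule.mem_span_pair.1 hw
      exact hr s t
  let Z (W : Submodule F E) : Set (Submodule L E) := pointsOf L {u | u ∈ W ∧ cubicMap g u = 0}
  change (Z U).ncard ≤ _ ∨ (Z U).ncard ≤ _
  have hZ (W : Submodule F E) (hW : finrank F W = 2) : (Z W).ncard ≤ Fintype.card F + 1 :=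
    (Set.ncard_le_ncard (pointsOf_mono fun u hu => hu.1)).trans (ncard_pointsOf_line_le hW)
  by_cases hempty : ∃ p ∈ U, p ≠ 0 ∧ cubicMap g p = 0
  swap
  · have : Z U = ∅ := by
      refine Set.eq_empty_of_forall_notMem ?_
      rintro _ ⟨u, ⟨hu, hfu⟩, hu0, -⟩
      exact hempty ⟨u, hu, hu0, hfu⟩
    simp [this]
  obtain ⟨p, hpU, hp0, hfp⟩ := hempty
  obtain ⟨W, hWU, hW, -, hfW⟩ := hlines p hpU hp0 hfp
  by_cases hall : ∀ u ∈ U, u ≠ 0 → cubicMap g u = 0 → u ∈ W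
  · have hsub : Z U ⊆ Z W := by
      rintro _ ⟨u, ⟨hu, hfu⟩, hu0, rfl⟩
      exact ⟨u, ⟨hall u hu hu0 hfu, hfu⟩, hu0, rfl⟩
    have h1 := Set.ncard_le_ncard hsub
    have h2 := hZ W hW
    exact Or.inl (by omega)
  push Not at hall
  obtain ⟨r, hrU, hr0, hfr, hrW⟩ := hall
  obtain ⟨W', hW'U, hW', hrW', hfW'⟩ := hlines r hrU hr0 hfr
  have hne : W ≠ W' := fun h => hrW (h ▸ hrW')
  obtain ⟨v, hli, hvU, h1W, h2W, h0W', h2W'⟩ :=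
    exists_frame_of_lines hU hWU hW'U hW hW' hne
  -- the third line
  obtain ⟨W'', hW''U, hW'', hcover⟩ : ∃ W'' : Submodule F E, W'' ≤ U ∧ finrank F W'' = 2 ∧
      ∀ u ∈ U, cubicMap g u = 0 → u ∈ W ∨ u ∈ W' ∨ u ∈ W'' := by
    obtain ⟨k, hk, -⟩ := exists_cubicMap_eq_ternaryCubic g hg v
    have hφk (x y z : F) : φ (cubicMap g (x • v 0 + y • v 1 + z • v 2)) =
        ternaryCubic (φ ∘ k) x y z := by
      rw [hk]
      simp [ternaryCubic]
    have hcoef := ternaryCubic_coeff_eq_zero (F := F) (c := φ ∘ k) hF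
      (fun y z => by
        rw [← hφk, zero_smul, zero_add]
        exact hfW _ (W.add_mem (W.smul_mem _ h1W) (W.smul_mem _ h2W)))
      (fun x z => by
        rw [← hφk, zero_smul, add_zero]
        exact hfW' _ (W'.add_mem (W'.smul_mem _ h0W') (W'.smul_mem _ h2W')))
    simp only [ternaryCubic_eq_of_coeff_eq_zero hcoef] at hφk
    let μ : Dual F (Fin 3 → F) := Fintype.linearCombination F ![φ (k 3), φ (k 5), φ (k 9)]
    have hμ : μ ≠ 0 := fun h => by
      obtain ⟨x, y, z, rfl⟩ := exists_coords_of_linearIndependent hU hvU hli hw₀U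
      have := LinearMap.congr_fun h ![x, y, z]
      simp only [μ, Fintype.linearCombination_apply, Fin.sum_univ_three, Matrix.cons_val,
        LinearMap.zero_apply] at this
      exact hφ (by simp only [hφk, Function.comp_apply, this, smul_zero])
    let e : (Fin 3 → F) →ₗ[F] E := Fintype.linearCombination F v
    have he : Function.Injective e := hli.fintypeLinearCombination_injective
    refine ⟨(LinearMap.ker μ).map e, ?_, ?_, fun u hu hfu => ?_⟩
    · rw [Submodule.map_le_iff_le_comap]
      intro x _
      simp only [e, Submodule.mem_comap, Fintype.linearCombination_apply]
      exact U.sum_mem fun i _ => U.smul_mem _ (hvU i)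
    · rw [← (Submodule.equivMapOfInjective e he _).finrank_eq]
      have h1 := LinearMap.finrank_range_add_finrank_ker μ
      have h2 : LinearMap.range μ = ⊤ := LinearMap.range_eq_top.2 (LinearMap.surjective hμ)
      rw [h2, finrank_top, finrank_self, finrank_fin_fun] at h1
      omega
    · obtain ⟨x, y, z, rfl⟩ := exists_coords_of_linearIndependent hU hvU hli hu
      have := hφk x y z
      rw [hfu, map_zero, eq_comm, smul_eq_zero, mul_eq_zero] at this
      rcases this with (rfl | rfl) | h
      · left
        rw [zero_smul, zero_add]
        exact W.add_mem (W.smul_mem _ h1W) (W.smul_mem _ h2W)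
      · right; left
        rw [zero_smul, add_zero]
        exact W'.add_mem (W'.smul_mem _ h0W') (W'.smul_mem _ h2W')
      · right; right
        refine ⟨![x, y, z], ?_, ?_⟩
        · simpa [μ, Fintype.linearCombination_apply, Fin.sum_univ_three] using h
        · simp [e, Fintype.linearCombination_apply, Fin.sum_univ_three]
  have hsub : Z U ⊆ Z W ∪ Z W' ∪ Z W'' := by
    rintro _ ⟨u, ⟨hu, hfu⟩, hu0, rfl⟩
    rcases hcover u hu hfu with h | h | h
    · exact Or.inl (Or.inl ⟨u, ⟨h, hfu⟩, hu0, rfl⟩)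
    · exact Or.inl (Or.inr ⟨u, ⟨h, hfu⟩, hu0, rfl⟩)
    · exact Or.inr ⟨u, ⟨h, hfu⟩, hu0, rfl⟩
  have hcard := Set.ncard_le_ncard hsub
  have hcup₁ := Set.ncard_union_le (Z W ∪ Z W') (Z W'')
  have hcup₂ := Set.ncard_union_le (Z W) (Z W')
  have hZW := hZ W hW
  have hZW' := hZ W' hW'
  have hZW'' := hZ W'' hW''
  by_cases hne₁ : W = W''
  · rw [← hne₁, Set.union_eq_left.2 Set.subset_union_left] at hcard
    exact Or.inl (by omega)
  by_cases hne₂ : W' = W''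
  · rw [← hne₂, Set.union_eq_left.2 Set.subset_union_right] at hcard
    exact Or.inl (by omega)
  have htwo (X Y : Submodule F E) (hX : X ≤ U) (hY : Y ≤ U) (hX2 : finrank F X = 2)
      (hY2 : finrank F Y = 2) (hXY : X ≠ Y) : (Z U).ncard ≤ 2 * Fintype.card F + 2 ∨
      (Z X).ncard ≤ 3 ∨ (Z Y).ncard ≤ 3 := by
    by_cases hfX : ∀ w ∈ X, cubicMap g w = 0
    · by_cases hfY : ∀ w ∈ Y, cubicMap g w = 0
      · exact Or.inl (ncard_pointsOf_le_of_two_lines g hF hE hg hU hX hY hX2 hY2 hXY hfX hfY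
          ⟨w₀, hw₀U, hw₀⟩)
      · push Not at hfY
        obtain ⟨w, hw, hfw⟩ := hfY
        exact Or.inr (Or.inr (ncard_pointsOf_line_cubicMap_le g hY2 hw hfw))
    · push Not at hfX
      obtain ⟨w, hw, hfw⟩ := hfX
      exact Or.inr (Or.inl (ncard_pointsOf_line_cubicMap_le g hX2 hw hfw))
  have t₁ := htwo W W' hWU hW'U hW hW' hne
  have t₂ := htwo W W'' hWU hW''U hW hW'' hne₁
  have t₃ := htwo W' W'' hW'U hW''U hW' hW'' hne₂
  omega

end CubicMap

section LinearSets

variable {F L : Type*} [Field F] [Fintype F] [Field L] [Algebra F L]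

/-- Elements of an extension of `F_q` on which the determinant of `q`-powers vanishes are linearly
dependent over `F_q`. -/
theorem exists_relation_of_det₃_frobenius_eq_zero (x : Fin 3 → L)
    (h : det₃ x (fun i => x i ^ Fintype.card F) (fun i => x i ^ Fintype.card F ^ 2) = 0) :
    ∃ a : Fin 3 → F, a ≠ 0 ∧ ∑ i, a i • x i = 0 := by
  classical
  set q := Fintype.card F with hq
  have hq1 : 1 < q := Fintype.one_lt_card
  by_contra! hx
  let M : Matrix (Fin 3) (Fin 3) L :=
    Matrix.of ![x, fun i => x i ^ q, fun i => x i ^ q ^ 2]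
  have hM : M.det = 0 := by
    rw [← h, Matrix.det_fin_three]
    simp only [M, det₃, Matrix.of_apply, Matrix.cons_val]
    ring
  obtain ⟨c, hc0, hc⟩ := Matrix.exists_vecMul_eq_zero_iff.2 hM
  let σ : L →ₐ[F] L := FiniteField.frobeniusAlgHom F L
  have hσ (y : L) : σ y = y ^ q := by simp [σ, hq]
  let P : L →ₗ[F] L := LinearMap.mulLeft F (c 0) + LinearMap.mulLeft F (c 1) ∘ₗ σ.toLinearMap +
    LinearMap.mulLeft F (c 2) ∘ₗ σ.toLinearMap ∘ₗ σ.toLinearMap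
  have hP (y : L) : P y = c 0 * y + c 1 * y ^ q + c 2 * y ^ q ^ 2 := by
    simp [P, hσ, pow_two q, pow_mul]
  have hPx (i : Fin 3) : P (x i) = 0 := by
    have := congrFun hc i
    simpa [Matrix.vecMul, dotProduct, Fin.sum_univ_three, M, hP] using this
  let p : Polynomial L := Polynomial.C (c 0) * Polynomial.X +
    Polynomial.C (c 1) * Polynomial.X ^ q + Polynomial.C (c 2) * Polynomial.X ^ q ^ 2
  have hqq : q < q ^ 2 := by nlinarith
  have hp : p ≠ 0 := fun hp => hc0 <| by
    have h0 := congrArg (Polynomial.coeff · 1) hp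
    have h1 := congrArg (Polynomial.coeff · q) hp
    have h2 := congrArg (Polynomial.coeff · (q ^ 2)) hp
    simp [p, Polynomial.coeff_X, Polynomial.coeff_X_pow, hq1.ne, hqq.ne, hqq.ne',
      (hq1.trans hqq).ne] at h0 h1 h2
    ext i
    fin_cases i <;> assumption
  have hdeg : p.natDegree ≤ q ^ 2 := by
    refine Polynomial.natDegree_add_le_of_degree_le (Polynomial.natDegree_add_le_of_degree_le
      ((Polynomial.natDegree_C_mul_le _ _).trans ?_) ((Polynomial.natDegree_C_mul_le _ _).trans ?_))
      ((Polynomial.natDegree_C_mul_le _ _).trans ?_)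
    · rw [Polynomial.natDegree_X]; omega
    · rw [Polynomial.natDegree_X_pow]; omega
    · rw [Polynomial.natDegree_X_pow]
  let e : (Fin 3 → F) →ₗ[F] L := Fintype.linearCombination F x
  have he : Function.Injective e := by
    rw [← LinearMap.ker_eq_bot, LinearMap.ker_eq_bot']
    intro a ha
    by_contra ha0
    exact hx a ha0 (by simpa [e, Fintype.linearCombination_apply] using ha)
  have hcard : (Finset.univ.image e).card ≤ p.natDegree := by
    refine Polynomial.card_le_degree_of_subset_roots fun y hy => ?_
    obtain ⟨a, -, rfl⟩ := Finset.mem_image.1 hy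
    refine (Polynomial.mem_roots hp).2 ?_
    have : P (e a) = 0 := by
      simp [e, Fintype.linearCombination_apply, hPx]
    rw [hP] at this
    simpa [p, Polynomial.IsRoot] using this
  rw [Finset.card_image_of_injective _ he, Finset.card_univ, Fintype.card_fun, Fintype.card_fin,
    ← hq] at hcard
  have : q ^ 2 < q ^ 3 := Nat.pow_lt_pow_right hq1 (by norm_num)
  omega

theorem det₃_frobenius_eq_zero_of_relation (x : Fin 3 → L) {a : Fin 3 → F} (ha : a ≠ 0)
    (h : ∑ i, a i • x i = 0) :
    det₃ x (fun i => x i ^ Fintype.card F) (fun i => x i ^ Fintype.card F ^ 2) = 0 := by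
  let σ : L →ₐ[F] L := FiniteField.frobeniusAlgHom F L
  have hσ (y : L) : σ y = y ^ Fintype.card F := by simp [σ]
  have h1 := congrArg σ h
  have h2 := congrArg σ h1
  simp only [map_sum, map_smul, map_zero] at h1 h2
  simp only [hσ, ← pow_mul, ← pow_two] at h1 h2
  let M : Matrix (Fin 3) (Fin 3) L :=
    Matrix.of ![x, fun i => x i ^ Fintype.card F, fun i => x i ^ Fintype.card F ^ 2]
  have hM : M.det = 0 := by
    refine Matrix.exists_mulVec_eq_zero_iff.1 ⟨fun i => algebraMap F L (a i), ?_, ?_⟩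
    · obtain ⟨i, hi⟩ := Function.ne_iff.1 ha
      exact Function.ne_iff.2 ⟨i, by simpa using hi⟩
    · simp only [Algebra.smul_def, mul_comm (algebraMap F L _)] at h h1 h2
      ext i
      fin_cases i <;> simpa [M, Matrix.mulVec, dotProduct]
  rw [← hM, Matrix.det_fin_three]
  simp only [M, det₃, Matrix.of_apply, Matrix.cons_val]
  ring

/-- The alternating form `u₀ w₁ - u₁ w₀` on `L²`, as a linear map in `w`. -/
def symplecticForm (u : Fin 2 → L) : (Fin 2 → L) →ₗ[L] L :=
  u 0 • LinearMap.proj 1 - u 1 • LinearMap.proj 0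

theorem symplecticForm_apply (u w : Fin 2 → L) : symplecticForm u w = u 0 * w 1 - u 1 * w 0 := by
  simp [symplecticForm]

theorem span_singleton_eq_iff_symplecticForm {u w : Fin 2 → L} (hu : u ≠ 0) (hw : w ≠ 0) :
    Submodule.span L {u} = Submodule.span L {w} ↔ symplecticForm u w = 0 := by
  rw [symplecticForm_apply]
  constructor
  · intro h
    obtain ⟨a, rfl⟩ := Submodule.mem_span_singleton.1 (h ▸ Submodule.mem_span_singleton_self w)
    simp only [Pi.smul_apply, smul_eq_mul]
    ring
  · intro h
    by_cases h0 : w 0 = 0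
    · have h1 : w 1 ≠ 0 := fun h1 => hw (by ext i; fin_cases i <;> assumption)
      refine span_singleton_eq_of_relation hu hw (a := w 1) (b := -u 1) (Or.inl h1) ?_
      ext i
      fin_cases i <;> simp
      · linear_combination h
      · ring
    · refine span_singleton_eq_of_relation hu hw (a := w 0) (b := -u 0) (Or.inl h0) ?_
      ext i
      fin_cases i <;> simp
      · ring
      · linear_combination -h

/-- The maps `w ↦ (⟨uᵢ, w⟩ ^ q ^ j)ᵢ`, where `⟨u, w⟩ = u₀ w₁ - u₁ w₀`. The zeros of the cubic map they
define are the vectors which span a point of the linear set of the span of `u₀`, `u₁`, `u₂`. -/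
def frobeniusForms (F : Type*) {L : Type*} [Field F] [Fintype F] [Field L] [Algebra F L]
    (u : Fin 3 → Fin 2 → L) (j : Fin 3) : (Fin 2 → L) →ₗ[F] (Fin 3 → L) :=
  LinearMap.pi fun i => ((FiniteField.frobeniusAlgHom F L) ^ (j : ℕ)).toLinearMap ∘ₗ
    (symplecticForm (u i)).restrictScalars F

theorem cubicMap_frobeniusForms (u : Fin 3 → Fin 2 → L) (w : Fin 2 → L) :
    cubicMap (frobeniusForms F u) w = det₃ (fun i => symplecticForm (u i) w)
      (fun i => symplecticForm (u i) w ^ Fintype.card F)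
      (fun i => symplecticForm (u i) w ^ Fintype.card F ^ 2) := by
  simp [cubicMap, det₃, frobeniusForms, pow_two (Fintype.card F), pow_mul]

theorem mem_pointsOf_iff_cubicMap_eq_zero {U : Submodule F (Fin 2 → L)} (hU : finrank F U = 3)
    {u : Fin 3 → Fin 2 → L} (hu : ∀ i, u i ∈ U) (hli : LinearIndependent F u) {w : Fin 2 → L}
    (hw : w ≠ 0) :
    Submodule.span L {w} ∈ pointsOf L (U : Set (Fin 2 → L)) ↔
      cubicMap (frobeniusForms F u) w = 0 := by
  have hform (a : Fin 3 → F) :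
      ∑ i, a i • symplecticForm (u i) w = symplecticForm (∑ i, a i • u i) w := by
    simp only [symplecticForm_apply, Fin.sum_univ_three, Pi.add_apply, Pi.smul_apply]
    simp only [Algebra.smul_def]
    ring
  rw [cubicMap_frobeniusForms]
  constructor
  · rintro ⟨u', hu', hu0, h⟩
    obtain ⟨x, y, z, rfl⟩ := exists_coords_of_linearIndependent hU hu hli hu'
    refine det₃_frobenius_eq_zero_of_relation _ (a := ![x, y, z]) ?_ ?_
    · intro h0
      have h0 : x = 0 ∧ y = 0 ∧ z = 0 := ⟨congrFun h0 0, congrFun h0 1, congrFun h0 2⟩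
      simp [h0] at hu0
    · rw [hform, ← span_singleton_eq_iff_symplecticForm _ hw]
      · simpa [Fin.sum_univ_three] using h.symm
      · simpa [Fin.sum_univ_three] using hu0
  · intro h
    obtain ⟨a, ha, hsum⟩ := exists_relation_of_det₃_frobenius_eq_zero _ h
    have hne : ∑ i, a i • u i ≠ 0 := fun h0 =>
      ha (funext (Fintype.linearIndependent_iff.1 hli a h0))
    rw [hform, ← span_singleton_eq_iff_symplecticForm hne hw] at hsum
    exact ⟨_, U.sum_mem fun i _ => U.smul_mem _ (hu i), hne, hsum.symm⟩

theorem ncard_inter_pointsOf_le [Finite L] (hF : 3 ≤ Fintype.card F)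
    {U₁ U₂ : Submodule F (Fin 2 → L)} (hU₁ : finrank F U₁ = 3) (hU₂ : finrank F U₂ = 3)
    (hsub : ¬ pointsOf L (U₁ : Set (Fin 2 → L)) ⊆ pointsOf L (U₂ : Set (Fin 2 → L))) :
    (pointsOf L (U₁ : Set (Fin 2 → L)) ∩ pointsOf L (U₂ : Set (Fin 2 → L))).ncard ≤
        2 * Fintype.card F + 2 ∨
      (pointsOf L (U₁ : Set (Fin 2 → L)) ∩ pointsOf L (U₂ : Set (Fin 2 → L))).ncard ≤
        Fintype.card F + 7 := by
  have : FiniteDimensional F U₂ := .of_finrank_pos (by omega)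
  let b : Basis (Fin 3) F U₂ := finBasisOfFinrankEq F U₂ hU₂
  let u (i : Fin 3) : Fin 2 → L := b i
  have hu : ∀ i, u i ∈ U₂ := fun i => (b i).2
  have hli : LinearIndependent F u := b.linearIndependent.map' U₂.subtype U₂.ker_subtype
  have hle : pointsOf L (U₁ : Set (Fin 2 → L)) ∩ pointsOf L (U₂ : Set (Fin 2 → L)) ⊆
      pointsOf L {w | w ∈ U₁ ∧ cubicMap (frobeniusForms F u) w = 0} := by
    rintro _ ⟨⟨w, hw, hw0, rfl⟩, hmem⟩
    exact ⟨w, ⟨hw, (mem_pointsOf_iff_cubicMap_eq_zero hU₂ hu hli hw0).1 hmem⟩, hw0, rfl⟩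
  obtain ⟨_, ⟨w, hw, hw0, rfl⟩, hmem⟩ := Set.not_subset.1 hsub
  have hcard := Set.ncard_le_ncard hle
  refine (ncard_pointsOf_cubicMap_le (frobeniusForms F u) hF (by simp) (fun a w => ?_) hU₁
    ⟨w, hw, fun h => hmem ((mem_pointsOf_iff_cubicMap_eq_zero hU₂ hu hli hw0).2 h)⟩).imp
    hcard.trans hcard.trans
  ext i
  simp [frobeniusForms]

end LinearSets

/-- Two distinct `F_q`-linear sets of rank `3` in `PG(1,q^h)`, `q > 3`, intersect in at
most `2q + 2` points if `q` is odd, and in at most `2q + 3` points if `q` is even. -/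
theorem rank_three_linear_sets_intersection (q h : ℕ) (hq3 : 3 < q) (hh : 0 < h)
    (F : Type) [Field F] [Fintype F] (hq : Fintype.card F = q)
    (L : Type) [Field L] [Fintype L] [Algebra F L] (hL : Fintype.card L = q ^ h)
    (U₁ U₂ : Submodule F (Fin 2 → L))
    (hU₁ : finrank F U₁ = 3) (hU₂ : finrank F U₂ = 3) :
    let B : Submodule F (Fin 2 → L) → Set (Submodule L (Fin 2 → L)) :=
      fun X => {P | ∃ x ∈ X, x ≠ 0 ∧ P = Submodule.span L {x}}
    B U₁ ≠ B U₂ →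
      (Odd q → (B U₁ ∩ B U₂).ncard ≤ 2 * q + 2) ∧
      (Even q → (B U₁ ∩ B U₂).ncard ≤ 2 * q + 3) := by
  intro B hB
  have hbound : (B U₁ ∩ B U₂).ncard ≤ 2 * q + 2 ∨ (B U₁ ∩ B U₂).ncard ≤ q + 7 := by
    rw [← hq]
    by_cases hsub : B U₁ ⊆ B U₂
    · rw [Set.inter_comm]
      exact ncard_inter_pointsOf_le (by omega) hU₂ hU₁ fun h => hB (hsub.antisymm h)
    · exact ncard_inter_pointsOf_le (by omega) hU₁ hU₂ hsub
  refine ⟨fun hodd => ?_, fun _ => by omega⟩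
  obtain ⟨m, rfl⟩ := hodd
  omega
end

section
/- Let q be a prime power, F = F_q. (a) Let L = F_{q³}, V = L², and let U₁, U₂ be F-subspaces of V of F-dimension 3. If |B(U₁)| = |B(U₂)| = q² + 1 (both are clubs), or if |B(U₁)| = |B(U₂)| = q² + q + 1 (both are scattered of rank 3), then there exists g ∈ GL(2, L) with B(g(U₁)) = B(U₂); i.e., all clubs in PG(1,q³) are projectively equivalent, and all scattered linear sets of rank 3 in PG(1,q³) are projectively equivalent. (b) Let L' = F_{q⁴} and V' = (L')²; if U₁, U₂ are F-subspaces of V' of F-dimension 3 with |B(U₁)| = |B(U₂)| = q² + q + 1, then there exists g ∈ GL(2, L') with B(g(U₁)) = B(U₂); i.e., all scattered linear sets of rank 3 in PG(1,q⁴) are projectively equivalent. -/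
open Module

section LinearSets

variable {F L : Type} [Field F] [Field L] [Algebra F L]

/-- The `F`-linear set of points of `PG(1, L)` defined by an `F`-subspace of `L²`. -/
def linearSet (U : Submodule F (Fin 2 → L)) : Set (Submodule L (Fin 2 → L)) :=
  {P | ∃ x ∈ U, x ≠ 0 ∧ P = Submodule.span L {x}}

/-- An `F`-subspace of `L²` is scattered if it meets every `L`-line in an `F`-space of dimension
at most one. -/
def IsScatteredSubspace (U : Submodule F (Fin 2 → L)) : Prop :=
  ∀ x ∈ U, x ≠ 0 → ∀ l : L, l • x ∈ U → ∃ c : F, l • x = c • x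

/-- The map sending a point of `PG(U)` to the point of `PG(1, L)` that it spans. -/
noncomputable def linearSetMap (U : Submodule F (Fin 2 → L)) (p : Projectivization F U) :
    Submodule L (Fin 2 → L) :=
  Submodule.span L {(p.rep : Fin 2 → L)}

lemma linearSetMap_mk (U : Submodule F (Fin 2 → L)) (x : U) (hx : x ≠ 0) :
    linearSetMap U (Projectivization.mk F x hx) = Submodule.span L {(x : Fin 2 → L)} := by
  obtain ⟨a, ha⟩ := Projectivization.exists_smul_eq_mk_rep F x hx
  have h : ((Projectivization.mk F x hx).rep : Fin 2 → L)
      = algebraMap F L (a : F) • (x : Fin 2 → L) := by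
    rw [← ha, algebraMap_smul]; rfl
  rw [linearSetMap, h]
  exact Submodule.span_singleton_smul_eq
    ((map_ne_zero_iff _ (algebraMap F L).injective).2 a.ne_zero).isUnit _

lemma range_linearSetMap (U : Submodule F (Fin 2 → L)) :
    Set.range (linearSetMap U) = linearSet U := by
  ext P
  constructor
  · rintro ⟨p, rfl⟩
    exact ⟨p.rep, p.rep.2, by simpa using p.rep_nonzero, rfl⟩
  · rintro ⟨x, hx, hx0, rfl⟩
    have h0 : (⟨x, hx⟩ : U) ≠ 0 := by simpa [Subtype.ext_iff] using hx0
    exact ⟨Projectivization.mk F ⟨x, hx⟩ h0, linearSetMap_mk U _ h0⟩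

lemma injective_linearSetMap_iff (U : Submodule F (Fin 2 → L)) :
    Function.Injective (linearSetMap U) ↔ IsScatteredSubspace U := by
  constructor
  · intro h x hx hx0 l hl
    by_cases hl0 : l = 0
    · exact ⟨0, by simp [hl0]⟩
    have h0 : (⟨x, hx⟩ : U) ≠ 0 := by simpa [Subtype.ext_iff] using hx0
    have h1 : (⟨l • x, hl⟩ : U) ≠ 0 := by simpa [Subtype.ext_iff, hl0] using hx0
    have := @h (Projectivization.mk F _ h1) (Projectivization.mk F _ h0) (by
      rw [linearSetMap_mk, linearSetMap_mk]
      exact Submodule.span_singleton_smul_eq (Ne.isUnit hl0) _)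
    rw [Projectivization.mk_eq_mk_iff'] at this
    obtain ⟨c, hc⟩ := this
    exact ⟨c, (congrArg Subtype.val hc).symm⟩
  · intro h p₁ p₂ hp
    induction p₁ using Projectivization.ind with | h x hx => ?_
    induction p₂ using Projectivization.ind with | h y hy => ?_
    rw [linearSetMap_mk, linearSetMap_mk] at hp
    have hmem : (x : Fin 2 → L) ∈ Submodule.span L {(y : Fin 2 → L)} :=
      hp ▸ Submodule.mem_span_singleton_self _
    obtain ⟨l, hl⟩ := Submodule.mem_span_singleton.1 hmem
    obtain ⟨c, hc⟩ := h y y.2 (by simpa using hy) l (hl ▸ x.2)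
    rw [Projectivization.mk_eq_mk_iff']
    exact ⟨c, Subtype.ext (by rw [← hl, hc]; rfl)⟩

lemma isScatteredSubspace_iff_ncard [Fintype F] [Finite L] {q : ℕ} (hq : Fintype.card F = q)
    (U : Submodule F (Fin 2 → L)) (hU : finrank F U = 3) :
    IsScatteredSubspace U ↔ (linearSet U).ncard = q ^ 2 + q + 1 := by
  have hcard : Nat.card (Projectivization F U) = q ^ 2 + q + 1 := by
    rw [Projectivization.card_of_finrank F U hU, Nat.card_eq_fintype_card, hq]
    simp [Finset.sum_range_succ]; ring
  have : Finite (Projectivization F U) := Nat.finite_of_card_ne_zero (by omega)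
  rw [← injective_linearSetMap_iff, ← range_linearSetMap, ← hcard, ← Nat.card_coe_set_eq]
  constructor
  · exact Nat.card_range_of_injective
  · intro h
    have := Function.Surjective.bijective_of_nat_card_le
      (Set.rangeFactorization_surjective (f := linearSetMap U)) h.ge
    exact Set.rangeFactorization_injective.1 this.injective

lemma exists_linearEquiv_of_pairs {x y x' y' : Fin 2 → L} (h : LinearIndependent L ![x, y])
    (h' : LinearIndependent L ![x', y']) :
    ∃ g : (Fin 2 → L) ≃ₗ[L] (Fin 2 → L), g x = x' ∧ g y = y' := by
  let b := basisOfLinearIndependentOfCardEqFinrank h (by simp)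
  let b' := basisOfLinearIndependentOfCardEqFinrank h' (by simp)
  have hb : ∀ i, b.equiv b' (Equiv.refl _) (![x, y] i) = ![x', y'] i := by
    intro i
    have := b.equiv_apply i b' (Equiv.refl _)
    simpa [b, b'] using this
  exact ⟨b.equiv b' (Equiv.refl _), hb 0, hb 1⟩

/-- Subspaces of codimension at most one of a finite extension, of equal dimension, differ by a
scalar. -/
lemma exists_smul_mem_of_finrank_le [FiniteDimensional F L] (W₁ W₂ : Submodule F L)
    (h : finrank F W₁ = finrank F W₂) (hL : finrank F L ≤ finrank F W₁ + 1) :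
    ∃ s : L, s ≠ 0 ∧ ∀ x, x ∈ W₁ ↔ s * x ∈ W₂ := by
  rcases eq_or_ne W₁ ⊤ with rfl | h₁
  · have : W₂ = ⊤ := Submodule.eq_top_of_finrank_eq (by rw [← h, finrank_top])
    exact ⟨1, one_ne_zero, by simp [this]⟩
  have h₂ : W₂ ≠ ⊤ := by
    rintro rfl
    exact h₁ (Submodule.eq_top_of_finrank_eq (by rw [h, finrank_top]))
  have key : ∀ W : Submodule F L, W ≠ ⊤ → finrank F L ≤ finrank F W + 1 →
      ∃ f : L →ₗ[F] F, f ≠ 0 ∧ W = LinearMap.ker f := by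
    intro W hW hd
    obtain ⟨f, hf, hle⟩ := W.exists_le_ker_of_lt_top hW.lt_top
    refine ⟨f, hf, Submodule.eq_of_le_of_finrank_le hle ?_⟩
    have := Module.Dual.finrank_ker_add_one_of_ne_zero hf
    omega
  obtain ⟨f₁, hf₁, rfl⟩ := key W₁ h₁ hL
  obtain ⟨f₂, hf₂, rfl⟩ := key W₂ h₂ (h ▸ hL)
  let T : L →ₗ[F] (L →ₗ[F] F) :=
    (LinearMap.mul F L).compr₂ f₂
  have hT : Function.Injective T := by
    rw [← LinearMap.ker_eq_bot, LinearMap.ker_eq_bot']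
    intro s hs
    by_contra hs0
    apply hf₂
    ext x
    have := LinearMap.congr_fun hs (s⁻¹ * x)
    simpa [T, mul_inv_cancel_left₀ hs0] using this
  have hsurj : Function.Surjective T :=
    (LinearMap.injective_iff_surjective_of_finrank_eq_finrank
      (Subspace.dual_finrank_eq (K := F) (V := L)).symm).1 hT
  obtain ⟨s, hs⟩ := hsurj f₁
  refine ⟨s, ?_, fun x => ?_⟩
  · rintro rfl
    exact hf₁ (by rw [← hs, map_zero])
  · simp [← hs, T]

lemma linearIndependent_pair_of_isScatteredSubspace {U : Submodule F (Fin 2 → L)}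
    (hU : IsScatteredSubspace U) {x y : Fin 2 → L} (hx : x ∈ U) (hy : y ∈ U)
    (h : LinearIndependent F ![x, y]) : LinearIndependent L ![x, y] := by
  have hx0 : x ≠ 0 := h.ne_zero 0
  rw [LinearIndependent.pair_iff' hx0] at h ⊢
  rintro l rfl
  obtain ⟨c, hc⟩ := hU x hx hx0 l hy
  exact h c hc.symm

lemma eq_zero_of_isScatteredSubspace_of_relations {U : Submodule F (Fin 2 → L)}
    (hU : IsScatteredSubspace U) {u v w : Fin 2 → L} (hu : u ∈ U) (hv : v ∈ U) (hw : w ∈ U)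
    (hind : ∀ x y z : F, x • u + y • v + z • w = 0 → x = 0 ∧ y = 0 ∧ z = 0)
    {a b c : L} (hrel : a • u + b • v + c • w = 0) {r s t : F}
    (hdep : r • a + s • b + t • c = 0) (ht : t ≠ 0) : a = 0 ∧ b = 0 ∧ c = 0 := by
  have ht' : algebraMap F L t ≠ 0 := (map_ne_zero_iff _ (algebraMap F L).injective).2 ht
  have hli : LinearIndependent L ![u - (r / t) • w, v - (s / t) • w] := by
    apply linearIndependent_pair_of_isScatteredSubspace hU
      (U.sub_mem hu (U.smul_mem _ hw)) (U.sub_mem hv (U.smul_mem _ hw))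
    rw [LinearIndependent.pair_iff]
    intro x y hxy
    have := hind x y (-(x * (r / t)) - y * (s / t)) (by rw [← hxy]; module)
    exact ⟨this.1, this.2.1⟩
  rw [LinearIndependent.pair_iff] at hli
  have hc : c = -(algebraMap F L (r / t) * a + algebraMap F L (s / t) * b) := by
    simp only [Algebra.smul_def] at hdep
    rw [map_div₀, map_div₀]
    field_simp
    linear_combination hdep
  obtain ⟨ha, hb⟩ := hli a b (by
    rw [← hrel, hc]
    simp only [← algebraMap_smul L (r / t), ← algebraMap_smul L (s / t)]
    module)
  exact ⟨ha, hb, by simp [hc, ha, hb]⟩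

lemma exists_linearIndependent_relation {U : Submodule F (Fin 2 → L)}
    (hU : IsScatteredSubspace U) {u : Fin 3 → Fin 2 → L} (hu : ∀ i, u i ∈ U)
    (hind : LinearIndependent F u) :
    ∃ a : Fin 3 → L, LinearIndependent F a ∧ ∑ i, a i • u i = 0 := by
  have hdep : ¬ LinearIndependent L u := by
    intro h
    simpa using h.fintype_card_le_finrank
  obtain ⟨a, ha, k, hk⟩ := Fintype.not_linearIndependent_iff.1 hdep
  refine ⟨a, ?_, ha⟩
  rw [Fintype.linearIndependent_iff] at hind ⊢
  have hind' : ∀ x y z : F, x • u 0 + y • u 1 + z • u 2 = 0 → x = 0 ∧ y = 0 ∧ z = 0 := by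
    intro x y z h
    have := hind ![x, y, z] (by simpa [Fin.sum_univ_three] using h)
    exact ⟨this 0, this 1, this 2⟩
  rw [Fin.sum_univ_three] at ha
  intro c hc
  rw [Fin.sum_univ_three] at hc
  have hcontra : ¬ (a 0 = 0 ∧ a 1 = 0 ∧ a 2 = 0) := by
    rintro ⟨h0, h1, h2⟩
    apply hk
    fin_cases k <;> assumption
  have h2 : c 2 = 0 := by
    by_contra h
    exact hcontra (eq_zero_of_isScatteredSubspace_of_relations hU (hu 0) (hu 1) (hu 2)
      hind' ha hc h)
  have h1 : c 1 = 0 := by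
    by_contra h
    have := eq_zero_of_isScatteredSubspace_of_relations hU (hu 0) (hu 2) (hu 1)
      (fun x y z e => by have := hind' x z y (by rw [← e]; abel); tauto)
      (by rw [← ha]; abel) (show c 0 • a 0 + c 2 • a 2 + c 1 • a 1 = 0 by rw [← hc]; abel) h
    tauto
  have h0 : c 0 = 0 := by
    by_contra h
    have := eq_zero_of_isScatteredSubspace_of_relations hU (hu 1) (hu 2) (hu 0)
      (fun x y z e => by have := hind' z x y (by rw [← e]; abel); tauto)
      (by rw [← ha]; abel) (show c 1 • a 1 + c 2 • a 2 + c 0 • a 0 = 0 by rw [← hc]; abel) h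
    tauto
  intro i
  fin_cases i <;> assumption

lemma exists_linearIndependent_mem {U : Submodule F (Fin 2 → L)} (hU : finrank F U = 3) :
    ∃ u : Fin 3 → Fin 2 → L, (∀ i, u i ∈ U) ∧ LinearIndependent F u ∧
      Submodule.span F (Set.range u) = U := by
  have : Module.Finite F U := Module.finite_of_finrank_eq_succ hU
  let b := finBasisOfFinrankEq F U hU
  refine ⟨fun i => b i, fun i => (b i).2,
    b.linearIndependent.map' U.subtype U.ker_subtype, ?_⟩
  have h := congrArg (Submodule.map U.subtype) b.span_eq
  rw [Submodule.map_span, ← Set.range_comp, Submodule.map_subtype_top] at h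
  exact h

lemma map_eq_of_span_eq {U₁ U₂ : Submodule F (Fin 2 → L)} [FiniteDimensional F U₂]
    (h : finrank F U₁ = finrank F U₂) (g : (Fin 2 → L) ≃ₗ[L] (Fin 2 → L))
    {s : Set (Fin 2 → L)} (hs : Submodule.span F s = U₁) (hg : ∀ x ∈ s, g x ∈ U₂) :
    U₁.map ((g.restrictScalars F : (Fin 2 → L) ≃ₗ[F] (Fin 2 → L)) :
      (Fin 2 → L) →ₗ[F] (Fin 2 → L)) = U₂ := by
  apply Submodule.eq_of_le_of_finrank_eq
  · rw [← hs, Submodule.map_span, Submodule.span_le]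
    rintro _ ⟨x, hx, rfl⟩
    exact hg x hx
  · rw [LinearEquiv.finrank_map_eq, h]

theorem exists_map_eq_of_isScatteredSubspace [FiniteDimensional F L] (hL : finrank F L ≤ 4)
    {U₁ U₂ : Submodule F (Fin 2 → L)} (h₁ : finrank F U₁ = 3) (h₂ : finrank F U₂ = 3)
    (hs₁ : IsScatteredSubspace U₁) (hs₂ : IsScatteredSubspace U₂) :
    ∃ g : (Fin 2 → L) ≃ₗ[L] (Fin 2 → L),
      U₁.map ((g.restrictScalars F : (Fin 2 → L) ≃ₗ[F] (Fin 2 → L)) :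
        (Fin 2 → L) →ₗ[F] (Fin 2 → L)) = U₂ := by
  obtain ⟨u, hu, hui, hus⟩ := exists_linearIndependent_mem h₁
  obtain ⟨v, hv, hvi, -⟩ := exists_linearIndependent_mem h₂
  obtain ⟨a, hai, ha⟩ := exists_linearIndependent_relation hs₁ hu hui
  obtain ⟨b, hbi, hb⟩ := exists_linearIndependent_relation hs₂ hv hvi
  have hfa : finrank F (Submodule.span F (Set.range a)) = 3 := by
    simpa using finrank_span_eq_card hai
  have hfb : finrank F (Submodule.span F (Set.range b)) = 3 := by
    simpa using finrank_span_eq_card hbi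
  obtain ⟨s, hs, hsW⟩ := exists_smul_mem_of_finrank_le (Submodule.span F (Set.range b))
    (Submodule.span F (Set.range a)) (by rw [hfa, hfb]) (by omega)
  have hM : ∀ j, ∃ m : Fin 3 → F, ∑ i, m i • a i = s * b j := fun j =>
    (Submodule.mem_span_range_iff_exists_fun F).1
      ((hsW _).1 (Submodule.subset_span ⟨j, rfl⟩))
  choose m hm using hM
  have hunit : IsUnit (Matrix.of m) := by
    rw [← Matrix.vecMul_injective_iff_isUnit]
    rw [← Matrix.coe_vecMulLinear, ← LinearMap.ker_eq_bot, LinearMap.ker_eq_bot']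
    intro x hx
    have hx' : ∀ i, ∑ j, x j * m j i = 0 := fun i => congrFun hx i
    rw [Fintype.linearIndependent_iff] at hbi
    refine funext (hbi x ?_)
    have : s * ∑ j, x j • b j = 0 := by
      calc s * ∑ j, x j • b j = ∑ j, x j • ∑ i, m j i • a i := by
            simp only [Finset.mul_sum, hm, mul_smul_comm]
        _ = ∑ i, (∑ j, x j * m j i) • a i := by
            simp only [Finset.smul_sum, Finset.sum_smul, smul_smul]
            exact Finset.sum_comm
        _ = 0 := by simp [hx']
    exact (mul_eq_zero.1 this).resolve_left hs
  let v' : Fin 3 → Fin 2 → L := fun i => ∑ j, m j i • v j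
  have hv' : ∀ i, v' i ∈ U₂ := fun i => U₂.sum_mem fun j _ => U₂.smul_mem _ (hv j)
  have hvi' : LinearIndependent F v' := by
    rw [Fintype.linearIndependent_iff] at hvi ⊢
    intro x hx
    have hz : Matrix.mulVec (Matrix.of m) x = 0 := by
      refine funext (hvi _ ?_)
      rw [← hx]
      simp only [v', Matrix.mulVec, dotProduct, Finset.smul_sum, Finset.sum_smul, smul_smul,
        Matrix.of_apply]
      rw [Finset.sum_comm]
      simp only [mul_comm]
    have := Matrix.mulVec_injective_iff_isUnit.2 hunit (hz.trans (Matrix.mulVec_zero _).symm)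
    exact fun i => congrFun this i
  have hav' : ∑ i, a i • v' i = 0 := by
    calc ∑ i, a i • v' i = ∑ j, (∑ i, m j i • a i) • v j := by
          simp only [v', Finset.smul_sum, Finset.sum_smul]
          rw [Finset.sum_comm]
          simp only [smul_assoc, smul_comm (a _) (m _ _)]
      _ = s • ∑ j, b j • v j := by simp only [hm, Finset.smul_sum, mul_smul]
      _ = 0 := by rw [hb, smul_zero]
  have hpair : ∀ w : Fin 3 → Fin 2 → L, LinearIndependent F w →
      LinearIndependent F ![w 0, w 1] := by
    intro w hw
    have := hw.comp ![0, 1] (by decide)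
    convert this using 1
    ext i
    fin_cases i <;> rfl
  obtain ⟨g, hg0, hg1⟩ := exists_linearEquiv_of_pairs
    (linearIndependent_pair_of_isScatteredSubspace hs₁ (hu 0) (hu 1) (hpair u hui))
    (linearIndependent_pair_of_isScatteredSubspace hs₂ (hv' 0) (hv' 1) (hpair v' hvi'))
  have hg2 : g (u 2) = v' 2 := by
    have h := congrArg g ha
    rw [← sub_eq_zero]
    refine (smul_eq_zero.1 ?_).resolve_left (hai.ne_zero 2)
    simp only [Fin.sum_univ_three, map_add, map_smul, map_zero, hg0, hg1] at h hav'
    rw [smul_sub, sub_eq_zero]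
    exact add_left_cancel (h.trans hav'.symm)
  have : FiniteDimensional F U₂ := Module.finite_of_finrank_eq_succ h₂
  refine ⟨g, map_eq_of_span_eq (h₁.trans h₂.symm) g hus ?_⟩
  rintro _ ⟨i, rfl⟩
  fin_cases i
  · exact hg0 ▸ hv' 0
  · exact hg1 ▸ hv' 1
  · exact hg2 ▸ hv' 2

/-- Normal form of a rank three subspace that is neither scattered nor contained in a point. -/
lemma exists_span_eq_of_not_isScatteredSubspace {U : Submodule F (Fin 2 → L)}
    (hU : finrank F U = 3) (hs : ¬ IsScatteredSubspace U) (h1 : (linearSet U).ncard ≠ 1) :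
    ∃ (x y : Fin 2 → L) (l : L), LinearIndependent L ![x, y] ∧
      LinearIndependent F ![1, l] ∧ Submodule.span F {x, l • x, y} = U := by
  unfold IsScatteredSubspace at hs
  push Not at hs
  obtain ⟨x, hx, hx0, l, hl, hc⟩ := hs
  have hy : ∃ y ∈ U, ∀ k : L, k • x ≠ y := by
    by_contra! hall
    apply h1
    rw [Set.ncard_eq_one]
    refine ⟨Submodule.span L {x}, ?_⟩
    ext P
    constructor
    · rintro ⟨y, hy, hy0, rfl⟩
      obtain ⟨k, rfl⟩ := hall y hy
      refine Submodule.span_singleton_smul_eq (Ne.isUnit ?_) _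
      rintro rfl
      exact hy0 (zero_smul _ _)
    · rintro rfl
      exact ⟨x, hx, hx0, rfl⟩
  obtain ⟨y, hy, hyx⟩ := hy
  have hxy : LinearIndependent L ![x, y] := (LinearIndependent.pair_iff' hx0).2 hyx
  have h1l : LinearIndependent F ![1, l] := by
    rw [LinearIndependent.pair_iff' one_ne_zero]
    rintro c rfl
    exact hc c (by rw [smul_assoc, one_smul])
  refine ⟨x, y, l, hxy, h1l, ?_⟩
  have : FiniteDimensional F U := Module.finite_of_finrank_eq_succ hU
  have hli : LinearIndependent F ![x, l • x, y] := by
    rw [Fintype.linearIndependent_iff]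
    intro c hcsum
    simp only [Fin.sum_univ_three, Matrix.cons_val] at hcsum
    rw [LinearIndependent.pair_iff] at hxy h1l
    obtain ⟨e1, e2⟩ := hxy (c 0 • 1 + c 1 • l) (c 2 • 1) (by
      rw [← hcsum, add_smul, smul_assoc, smul_assoc, smul_assoc, one_smul, one_smul])
    obtain ⟨e3, e4⟩ := h1l _ _ e1
    have e5 : c 2 = 0 := (smul_eq_zero.1 e2).resolve_right one_ne_zero
    intro i
    fin_cases i <;> assumption
  have hr : Set.range ![x, l • x, y] = {x, l • x, y} := by
    simp only [Matrix.range_cons, Matrix.range_empty, Set.union_empty, Set.singleton_union]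
  apply Submodule.eq_of_le_of_finrank_eq
  · rw [Submodule.span_le]
    rintro z (rfl | rfl | rfl) <;> assumption
  · rw [hU, ← hr, finrank_span_eq_card hli]
    rfl

theorem exists_map_eq_of_not_isScatteredSubspace [FiniteDimensional F L] (hL : finrank F L ≤ 3)
    {U₁ U₂ : Submodule F (Fin 2 → L)} (h₁ : finrank F U₁ = 3) (h₂ : finrank F U₂ = 3)
    (hs₁ : ¬ IsScatteredSubspace U₁) (hs₂ : ¬ IsScatteredSubspace U₂)
    (hn₁ : (linearSet U₁).ncard ≠ 1) (hn₂ : (linearSet U₂).ncard ≠ 1) :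
    ∃ g : (Fin 2 → L) ≃ₗ[L] (Fin 2 → L),
      U₁.map ((g.restrictScalars F : (Fin 2 → L) ≃ₗ[F] (Fin 2 → L)) :
        (Fin 2 → L) →ₗ[F] (Fin 2 → L)) = U₂ := by
  obtain ⟨x₁, y₁, l₁, hxy₁, hl₁, hspan₁⟩ :=
    exists_span_eq_of_not_isScatteredSubspace h₁ hs₁ hn₁
  obtain ⟨x₂, y₂, l₂, hxy₂, hl₂, hspan₂⟩ :=
    exists_span_eq_of_not_isScatteredSubspace h₂ hs₂ hn₂
  have hd : ∀ l : L, LinearIndependent F ![1, l] →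
      finrank F (Submodule.span F (Set.range ![1, l])) = 2 := fun l hl => by
    simpa using finrank_span_eq_card hl
  obtain ⟨s, hs, hsW⟩ := exists_smul_mem_of_finrank_le (Submodule.span F (Set.range ![1, l₁]))
    (Submodule.span F (Set.range ![1, l₂])) (by rw [hd _ hl₁, hd _ hl₂])
    (by rw [hd _ hl₁]; exact hL)
  have hx₂ : x₂ ∈ U₂ := hspan₂ ▸ Submodule.subset_span (by simp)
  have hlx₂ : l₂ • x₂ ∈ U₂ := hspan₂ ▸ Submodule.subset_span (by simp)
  have hy₂ : y₂ ∈ U₂ := hspan₂ ▸ Submodule.subset_span (by simp)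
  have hmem : ∀ k ∈ Submodule.span F (Set.range ![1, l₁]), (s * k) • x₂ ∈ U₂ := by
    intro k hk
    obtain ⟨c, hc⟩ := (Submodule.mem_span_range_iff_exists_fun F).1 ((hsW k).1 hk)
    rw [← hc]
    simp only [Fin.sum_univ_two, Matrix.cons_val_zero, Matrix.cons_val_one, add_smul,
      smul_assoc, one_smul]
    exact U₂.add_mem (U₂.smul_mem _ hx₂) (U₂.smul_mem _ hlx₂)
  have hxy₂' : LinearIndependent L ![s • x₂, y₂] := by
    rw [LinearIndependent.pair_iff] at hxy₂ ⊢
    intro c d hcd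
    obtain ⟨e1, e2⟩ := hxy₂ (c * s) d (by rw [mul_smul, hcd])
    exact ⟨(mul_eq_zero.1 e1).resolve_right hs, e2⟩
  obtain ⟨g, hgx, hgy⟩ := exists_linearEquiv_of_pairs hxy₁ hxy₂'
  have : FiniteDimensional F U₂ := Module.finite_of_finrank_eq_succ h₂
  refine ⟨g, map_eq_of_span_eq (h₁.trans h₂.symm) g hspan₁ ?_⟩
  rintro z (rfl | rfl | rfl)
  · rw [hgx]
    simpa using hmem 1 (Submodule.subset_span ⟨0, rfl⟩)
  · rw [map_smul, hgx, smul_smul, mul_comm]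
    exact hmem l₁ (Submodule.subset_span ⟨1, rfl⟩)
  · rwa [hgy]

lemma finrank_eq_of_card_eq_pow [Fintype F] [Fintype L] {q t : ℕ} (hq : Fintype.card F = q)
    (hL : Fintype.card L = q ^ t) : finrank F L = t := by
  have h := Module.card_eq_pow_finrank (K := F) (V := L)
  rw [hL, hq] at h
  exact (Nat.pow_right_injective (hq ▸ Fintype.one_lt_card) h).symm

end LinearSets

/-- (a) All clubs in `PG(1,q³)` are projectively equivalent, and all scattered linear
sets of rank `3` in `PG(1,q³)` are projectively equivalent.  (b) All scattered linear
sets of rank `3` in `PG(1,q⁴)` are projectively equivalent.  Here a club is a linear set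
of rank `3` of size `q² + 1` and a scattered linear set of rank `3` has size
`q² + q + 1`; equivalence is via an element of `GL(2, F_{q^t})`. -/
theorem clubs_and_scattered_equivalence (q : ℕ)
    (F : Type) [Field F] [Fintype F] (hq : Fintype.card F = q)
    (L : Type) [Field L] [Fintype L] [Algebra F L] (hL : Fintype.card L = q ^ 3)
    (L' : Type) [Field L'] [Fintype L'] [Algebra F L'] (hL' : Fintype.card L' = q ^ 4) :
    let B : Submodule F (Fin 2 → L) → Set (Submodule L (Fin 2 → L)) :=
      fun X => {P | ∃ x ∈ X, x ≠ 0 ∧ P = Submodule.span L {x}}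
    let B' : Submodule F (Fin 2 → L') → Set (Submodule L' (Fin 2 → L')) :=
      fun X => {P | ∃ x ∈ X, x ≠ 0 ∧ P = Submodule.span L' {x}}
    (∀ U₁ U₂ : Submodule F (Fin 2 → L), finrank F U₁ = 3 → finrank F U₂ = 3 →
      (B U₁).ncard = q ^ 2 + 1 → (B U₂).ncard = q ^ 2 + 1 →
      ∃ g : (Fin 2 → L) ≃ₗ[L] (Fin 2 → L),
        B (U₁.map ((g.restrictScalars F : (Fin 2 → L) ≃ₗ[F] (Fin 2 → L)) :
          (Fin 2 → L) →ₗ[F] (Fin 2 → L))) = B U₂) ∧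
    (∀ U₁ U₂ : Submodule F (Fin 2 → L), finrank F U₁ = 3 → finrank F U₂ = 3 →
      (B U₁).ncard = q ^ 2 + q + 1 → (B U₂).ncard = q ^ 2 + q + 1 →
      ∃ g : (Fin 2 → L) ≃ₗ[L] (Fin 2 → L),
        B (U₁.map ((g.restrictScalars F : (Fin 2 → L) ≃ₗ[F] (Fin 2 → L)) :
          (Fin 2 → L) →ₗ[F] (Fin 2 → L))) = B U₂) ∧
    (∀ U₁ U₂ : Submodule F (Fin 2 → L'), finrank F U₁ = 3 → finrank F U₂ = 3 →
      (B' U₁).ncard = q ^ 2 + q + 1 → (B' U₂).ncard = q ^ 2 + q + 1 →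
      ∃ g : (Fin 2 → L') ≃ₗ[L'] (Fin 2 → L'),
        B' (U₁.map ((g.restrictScalars F : (Fin 2 → L') ≃ₗ[F] (Fin 2 → L')) :
          (Fin 2 → L') →ₗ[F] (Fin 2 → L')))= B' U₂) := by
  intro B B'
  have hq1 : 1 < q := hq ▸ Fintype.one_lt_card
  have h3 : finrank F L = 3 := finrank_eq_of_card_eq_pow hq hL
  have h4 : finrank F L' = 4 := finrank_eq_of_card_eq_pow hq hL'
  refine ⟨fun U₁ U₂ h₁ h₂ hB₁ hB₂ => ?_, fun U₁ U₂ h₁ h₂ hB₁ hB₂ => ?_,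
    fun U₁ U₂ h₁ h₂ hB₁ hB₂ => ?_⟩
  · have hB₁' : (linearSet U₁).ncard = q ^ 2 + 1 := hB₁
    have hB₂' : (linearSet U₂).ncard = q ^ 2 + 1 := hB₂
    have hpos : 0 < q ^ 2 := by positivity
    obtain ⟨g, hg⟩ := exists_map_eq_of_not_isScatteredSubspace h3.le h₁ h₂
      (by rw [isScatteredSubspace_iff_ncard hq U₁ h₁]; omega)
      (by rw [isScatteredSubspace_iff_ncard hq U₂ h₂]; omega) (by omega) (by omega)
    exact ⟨g, congrArg B hg⟩
  · obtain ⟨g, hg⟩ := exists_map_eq_of_isScatteredSubspace (by omega) h₁ h₂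
      ((isScatteredSubspace_iff_ncard hq U₁ h₁).2 hB₁)
      ((isScatteredSubspace_iff_ncard hq U₂ h₂).2 hB₂)
    exact ⟨g, congrArg B hg⟩
  · obtain ⟨g, hg⟩ := exists_map_eq_of_isScatteredSubspace h4.le h₁ h₂
      ((isScatteredSubspace_iff_ncard hq U₁ h₁).2 hB₁)
      ((isScatteredSubspace_iff_ncard hq U₂ h₂).2 hB₂)
    exact ⟨g, congrArg B' hg⟩
end

section
/- Let q be a prime power, r ≥ 1 and t ≥ 2, F = F_q, L = F_{q^t}, and M = L^r. Let σ be a field automorphism of L whose fixed field is exactly F, let f : M → M be a bijective σ-semilinear map (additive with f(c x) = σ(c) f(x)), and let ρ ∈ L, ρ ≠ 0. Set W = { (u, ρ f(u)) : u ∈ M } ⊆ M × M = L^{2r}. Then W is an F-subspace of L^{2r} (regarded as an F-vector space) of F-dimension rt, and W is scattered: for every nonzero w ∈ W, (L·w) ∩ W = F·w. In particular, B(W) = { L·w : w ∈ W, w ≠ 0 } is a maximum scattered F_q-linear set of rank rt in PG(2r-1,q^t). -/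
open Module

/-- The graph `u ↦ (u, ρ f(u))` of a scaled `σ`-semilinear map, as a linear map over a subfield
fixed by `σ`. -/
def semilinearGraphMap {F L M : Type*} [CommSemiring F] [CommSemiring L] [Algebra F L]
    [AddCommMonoid M] [Module L M] [Module F M] [IsScalarTower F L M] {σ : L ≃+* L}
    (hσ : ∀ a : F, σ (algebraMap F L a) = algebraMap F L a) (f : M →ₛₗ[(σ : L →+* L)] M) (ρ : L) :
    M →ₗ[F] M × M where
  toFun u := (u, ρ • f u)
  map_add' x y := by simp
  map_smul' a x := by
    have h : f (a • x) = a • f x := by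
      rw [← algebraMap_smul L a x, f.map_smulₛₗ, RingEquiv.coe_toRingHom, hσ, algebraMap_smul]
    ext1
    · rfl
    · simp only [h, RingHom.id_apply, Prod.smul_mk]
      rw [← algebraMap_smul L a (f x), ← algebraMap_smul L a (ρ • f x), smul_comm]

/-- If `(u, ρ f(u))` and an `L`-multiple of it both lie on the graph, the multiplier is fixed
by `σ`. -/
theorem map_eq_self_of_smul_graph_eq {L M : Type*} [Field L] [AddCommGroup M] [Module L M]
    {σ : L ≃+* L} {f : M →ₛₗ[(σ : L →+* L)] M} (hf : Function.Injective f) {ρ : L} (hρ : ρ ≠ 0)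
    {u v : M} (hu : u ≠ 0) {c : L} (h : c • (u, ρ • f u) = (v, ρ • f v)) : σ c = c := by
  obtain ⟨rfl, h⟩ := Prod.mk.inj h
  rw [f.map_smulₛₗ, RingEquiv.coe_toRingHom, smul_comm c ρ] at h
  have hfu : f u ≠ 0 := (map_ne_zero_iff f hf).2 hu
  exact (smul_left_injective L hfu (smul_right_injective M hρ h)).symm

/-- (Lunardon–Marino–Polverino–Trombetti) Let `σ` be a field automorphism of
`L = F_{q^t}` with fixed field exactly `F = F_q`, let `f : L^r → L^r` be a bijective
`σ`-semilinear map, and `ρ ∈ L*`.  Then `W = {(u, ρ f(u)) : u ∈ L^r} ⊆ L^r × L^r` is an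
`F`-subspace of `F`-dimension `rt` which is scattered: for every nonzero `w ∈ W`, the
`L`-line through `w` meets `W` exactly in the `F`-line through `w`.  Hence `B(W)` is a
maximum scattered `F_q`-linear set of rank `rt` in `PG(2r-1,q^t)` (of pseudoregulus
type). -/
theorem pseudoregulus_type_scattered (q r t : ℕ) (hr : 0 < r) (ht : 2 ≤ t)
    (F : Type) [Field F] [Fintype F] (hq : Fintype.card F = q)
    (L : Type) [Field L] [Fintype L] [Algebra F L] (hL : Fintype.card L = q ^ t)
    (σ : L ≃+* L) (hσ : ∀ c : L, σ c = c ↔ c ∈ (algebraMap F L).range)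
    (f : (Fin r → L) → (Fin r → L)) (hfbij : Function.Bijective f)
    (hfadd : ∀ x y, f (x + y) = f x + f y)
    (hfsemi : ∀ (c : L) (x), f (c • x) = σ c • f x)
    (ρ : L) (hρ : ρ ≠ 0) :
    ∃ W : Submodule F ((Fin r → L) × (Fin r → L)),
      (W : Set ((Fin r → L) × (Fin r → L))) = {p | ∃ u : Fin r → L, p = (u, ρ • f u)} ∧
      finrank F W = r * t ∧
      ∀ w ∈ W, w ≠ 0 →
        (Submodule.span L {w}).restrictScalars F ⊓ W = Submodule.span F {w} := by
  have hfix : ∀ a : F, σ (algebraMap F L a) = algebraMap F L a := fun a => (hσ _).2 ⟨a, rfl⟩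
  let φ : (Fin r → L) →ₛₗ[(σ : L →+* L)] (Fin r → L) :=
    { toFun := f, map_add' := hfadd, map_smul' := hfsemi }
  let g := semilinearGraphMap hfix φ ρ
  have hg : Function.Injective g := fun x y h => congrArg Prod.fst h
  have hmem : ∀ p, p ∈ LinearMap.range g ↔ ∃ u, p = (u, ρ • f u) :=
    fun p => exists_congr fun u => eq_comm
  have hdeg : finrank F L = t := by
    have h := Module.card_eq_pow_finrank (K := F) (V := L)
    rw [hL, ← hq] at h
    exact (Nat.pow_right_injective Fintype.one_lt_card h).symm
  refine ⟨LinearMap.range g, Set.ext hmem, ?_, fun w hw hw0 => le_antisymm ?_ ?_⟩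
  · rw [LinearMap.finrank_range_of_inj hg, Module.finrank_pi_fintype]
    simp [hdeg]
  · rintro x ⟨hx, hxW⟩
    obtain ⟨c, rfl⟩ := Submodule.mem_span_singleton.1 hx
    obtain ⟨u, rfl⟩ := hw
    obtain ⟨v, hv⟩ := hxW
    have hu : u ≠ 0 := by
      rintro rfl
      exact hw0 (map_zero g)
    have hc : σ c = c :=
      map_eq_self_of_smul_graph_eq (f := φ) hfbij.injective hρ hu hv.symm
    obtain ⟨a, rfl⟩ := (hσ c).1 hc
    exact Submodule.mem_span_singleton.2 ⟨a, (algebraMap_smul L a _).symm⟩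
  · rw [Submodule.span_singleton_le_iff_mem]
    exact ⟨Submodule.mem_span_singleton_self w, hw⟩
end
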